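/- Let λ : [0,1] → ℝ satisfy Assumption 1 (with subpower function φ) and Assumption 2 (with constants c₀, y₀, β), let λⁿ be its square-root interpolation, and let γ and γⁿ be the traces of the Loewner evolutions driven by λ and λⁿ respectively. Then there exists a subpower function φ̃, depending only on φ, c₀ and β, such that for all n ≥ 1/y₀² and all t ∈ [0,1], |γⁿ(t) − γ(t)| ≤ φ̃(n) / n^{(1/2)(1 − √((1+β)/2))}. -/

import Mathlib

open MeasureTheory Filter Set

noncomputable section

/-- The open upper half-plane. -/
def UHP : Set ℂ := {z : ℂ | 0 < z.im}

/-- `f` is the forward Loewner flow of the driver `lam` started at `z`,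
existing (staying in the upper half-plane) on `[0, t]`. -/
def IsFwdSolOn (lam : ℝ → ℝ) (z : ℂ) (f : ℝ → ℂ) (t : ℝ) : Prop :=
  f 0 = z ∧ ∀ s ∈ Set.Icc (0:ℝ) t, 0 < (f s).im ∧
    HasDerivAt f (2 / (f s - (lam s : ℂ))) s

/-- A (forward) Loewner chain on `[0, T]` for the driver `lam`: the conformal maps `g t`
from their domains `H t` (the set of points whose Loewner flow exists up to time `t`)
onto the upper half-plane, together with the inverse maps `finv t`. -/
structure FwdLoewnerChain (lam : ℝ → ℝ) (T : ℝ) where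
  g : ℝ → ℂ → ℂ
  H : ℝ → Set ℂ
  finv : ℝ → ℂ → ℂ
  mem_H : ∀ t ∈ Set.Icc (0:ℝ) T, ∀ z : ℂ,
    z ∈ H t ↔ (0 < z.im ∧ IsFwdSolOn lam z (fun s => g s z) t)
  bijOn : ∀ t ∈ Set.Icc (0:ℝ) T, Set.BijOn (g t) (H t) UHP
  g_holo : ∀ t ∈ Set.Icc (0:ℝ) T, DifferentiableOn ℂ (g t) (H t)
  finv_maps : ∀ t ∈ Set.Icc (0:ℝ) T, ∀ w ∈ UHP, finv t w ∈ H t ∧ g t (finv t w) = w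
  finv_holo : ∀ t ∈ Set.Icc (0:ℝ) T, DifferentiableOn ℂ (finv t) UHP

/-- `γ` is the trace of the Loewner chain `ch` with driver `lam` on `[0,T]`:
the continuous curve `γ t = lim_{y→0+} g_t⁻¹ (lam t + i y)`. -/
def HasTrace (lam : ℝ → ℝ) (T : ℝ) (ch : FwdLoewnerChain lam T) (γ : ℝ → ℂ) : Prop :=
  ContinuousOn γ (Set.Icc 0 T) ∧
  ∀ t ∈ Set.Icc (0:ℝ) T,
    Tendsto (fun y : ℝ => ch.finv t ((lam t : ℂ) + y * Complex.I))
      (nhdsWithin 0 (Set.Ioi 0)) (nhds (γ t))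

/-- A subpower function: a nonnegative function growing slower than any positive power. -/
def IsSubpower (φ : ℝ → ℝ) : Prop :=
  (∀ x, 0 ≤ φ x) ∧ ∀ ε : ℝ, 0 < ε → Tendsto (fun x => φ x / x ^ ε) atTop (nhds 0)

/-- The modulus of continuity `osc(f, δ)` of `f` on `[0,1]`. -/
def osc (f : ℝ → ℝ) (δ : ℝ) : ℝ :=
  sSup {d : ℝ | ∃ s ∈ Set.Icc (0:ℝ) 1, ∃ t ∈ Set.Icc (0:ℝ) 1, |t - s| ≤ δ ∧ d = |f t - f s|}

/-- The piecewise square-root interpolation `λⁿ` of a driver `lam`, with nodes `t_k = k/n`: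
on `[t_k, t_{k+1}]` it equals `√n (λ(t_{k+1}) - λ(t_k)) √(t - t_k) + λ(t_k)`. -/
def sqrtInterp (lam : ℝ → ℝ) (n : ℕ) (t : ℝ) : ℝ :=
  Real.sqrt n * (lam (((⌊t * (n:ℝ)⌋₊ : ℝ) + 1) / n) - lam ((⌊t * (n:ℝ)⌋₊ : ℝ) / n)) *
      Real.sqrt (t - (⌊t * (n:ℝ)⌋₊ : ℝ) / n) + lam ((⌊t * (n:ℝ)⌋₊ : ℝ) / n)

/-- A reverse Loewner flow on `[a,b]` with driver `ξ`. -/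
def RevSol (ξ : ℝ → ℝ) (h : ℝ → ℂ) (a b : ℝ) : Prop :=
  ∀ u ∈ Set.Icc a b, 0 < (h u).im ∧ HasDerivAt h (-2 / (h u - (ξ u : ℂ))) u

/-- The squared distance of the flow to the driver. -/
def sqd (ξ : ℝ → ℝ) (h : ℝ → ℂ) (u : ℝ) : ℝ := ((h u).re - ξ u) ^ 2 + (h u).im ^ 2

lemma RevSol.mono {ξ h a b a' b'} (H : RevSol ξ h a b) (ha : a ≤ a') (hb : b' ≤ b) :
    RevSol ξ h a' b' := fun u hu => H u ⟨ha.trans hu.1, hu.2.trans hb⟩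

lemma RevSol.sqd_pos {ξ h a b u} (H : RevSol ξ h a b) (hu : u ∈ Set.Icc a b) :
    0 < sqd ξ h u := by
  have := (H u hu).1
  unfold sqd; positivity

lemma RevSol.hasDeriv_im {ξ h a b u} (H : RevSol ξ h a b) (hu : u ∈ Set.Icc a b) :
    HasDerivAt (fun v => (h v).im) (2 * (h u).im / sqd ξ h u) u := by
  have h1 := (H u hu).2
  have h2 := (Complex.imCLM.hasFDerivAt (x := h u)).comp_hasDerivAt u h1
  have : Complex.imCLM (-2 / (h u - (ξ u : ℂ))) = 2 * (h u).im / sqd ξ h u := by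
    simp [Complex.div_im, Complex.normSq_apply, sqd, pow_two]
    ring
  rw [this] at h2
  exact h2

lemma RevSol.hasDeriv_re {ξ h a b u} (H : RevSol ξ h a b) (hu : u ∈ Set.Icc a b) :
    HasDerivAt (fun v => (h v).re) (-2 * ((h u).re - ξ u) / sqd ξ h u) u := by
  have h1 := (H u hu).2
  have h2 := (Complex.reCLM.hasFDerivAt (x := h u)).comp_hasDerivAt u h1
  have : Complex.reCLM (-2 / (h u - (ξ u : ℂ))) = -2 * ((h u).re - ξ u) / sqd ξ h u := by
    simp [Complex.div_re, Complex.normSq_apply, sqd, pow_two]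
  rw [this] at h2
  exact h2

lemma RevSol.im_mono {ξ h a b} (H : RevSol ξ h a b) :
    MonotoneOn (fun v => (h v).im) (Set.Icc a b) := by
  apply monotoneOn_of_deriv_nonneg (convex_Icc a b)
  · intro u hu
    exact (H.hasDeriv_im hu).continuousAt.continuousWithinAt
  · intro u hu
    exact (H.hasDeriv_im (interior_subset hu)).differentiableAt.differentiableWithinAt
  · intro u hu
    rw [(H.hasDeriv_im (interior_subset hu)).deriv]
    have := (H u (interior_subset hu)).1
    have := H.sqd_pos (interior_subset hu)
    positivity

lemma RevSol.im_le {ξ h a b u} (H : RevSol ξ h a b) (hu : u ∈ Set.Icc a b) :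
    (h u).im ^ 2 ≤ (h a).im ^ 2 + 4 * (u - a) := by
  have key : AntitoneOn (fun v => (h v).im ^ 2 - 4 * v) (Set.Icc a b) := by
    have hd : ∀ u ∈ Set.Icc a b, HasDerivAt (fun v => (h v).im ^ 2 - 4 * v)
        (2 * (h u).im * (2 * (h u).im / sqd ξ h u) - 4) u := by
      intro u hu
      have := ((H.hasDeriv_im hu).pow 2).sub ((hasDerivAt_id u).const_mul 4)
      refine this.congr_deriv ?_
      simp
    apply antitoneOn_of_deriv_nonpos (convex_Icc a b)
    · intro u hu
      exact (hd u hu).continuousAt.continuousWithinAt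
    · intro u hu
      exact (hd u (interior_subset hu)).differentiableAt.differentiableWithinAt
    · intro u hu
      rw [(hd u (interior_subset hu)).deriv]
      have h1 := H.sqd_pos (interior_subset hu)
      have : 2 * (h u).im * (2 * (h u).im / sqd ξ h u) ≤ 4 := by
        rw [← mul_div_assoc, div_le_iff₀ h1]
        unfold sqd
        nlinarith [sq_nonneg ((h u).re - ξ u)]
      linarith
  have := key (Set.left_mem_Icc.2 (hu.1.trans hu.2)) hu hu.1
  linarith

/-- Barrier for the real part from above. -/
lemma RevSol.re_le {ξ h a b u M} (H : RevSol ξ h a b) (hu : u ∈ Set.Icc a b)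
    (h0 : (h a).re ≤ M) (hξ : ∀ v ∈ Set.Icc a b, ξ v ≤ M) : (h u).re ≤ M := by
  apply le_of_forall_pos_le_add
  intro ε hε
  have := image_le_of_deriv_right_lt_deriv_boundary' (f := fun v => (h v).re)
    (f' := fun u => -2 * ((h u).re - ξ u) / sqd ξ h u) (a := a) (b := b)
    (B := fun _ => M + ε) (B' := fun _ => 0)
    (fun u hu => (H.hasDeriv_re hu).continuousAt.continuousWithinAt)
    (fun u hu => (H.hasDeriv_re (Set.Ico_subset_Icc_self hu)).hasDerivWithinAt)
    (by linarith) continuousOn_const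
    (fun u hu => hasDerivWithinAt_const _ _ _)
    (by
      intro u hu he
      have hu' := Set.Ico_subset_Icc_self hu
      have h1 := H.sqd_pos hu'
      have h2 := hξ u hu'
      apply div_neg_of_neg_of_pos _ h1
      linarith)
  exact this hu

lemma RevSol.re_ge {ξ h a b u M} (H : RevSol ξ h a b) (hu : u ∈ Set.Icc a b)
    (h0 : M ≤ (h a).re) (hξ : ∀ v ∈ Set.Icc a b, M ≤ ξ v) : M ≤ (h u).re := by
  apply le_of_forall_pos_le_add
  intro ε hε
  have := image_le_of_deriv_right_lt_deriv_boundary' (f := fun v => -(h v).re)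
    (f' := fun u => -(-2 * ((h u).re - ξ u) / sqd ξ h u)) (a := a) (b := b)
    (B := fun _ => -M + ε) (B' := fun _ => 0)
    (fun u hu => (H.hasDeriv_re hu).neg.continuousAt.continuousWithinAt)
    (fun u hu => (H.hasDeriv_re (Set.Ico_subset_Icc_self hu)).neg.hasDerivWithinAt)
    (by linarith) continuousOn_const
    (fun u hu => hasDerivWithinAt_const _ _ _)
    (by
      intro u hu he
      have hu' := Set.Ico_subset_Icc_self hu
      have h1 := H.sqd_pos hu'
      have h2 := hξ u hu'
      rw [neg_lt_zero]
      apply div_pos _ h1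
      linarith)
  have := this hu
  linarith

/-- The real part stays within the oscillation of the driver. -/
lemma RevSol.abs_re {ξ h a b u M c} (H : RevSol ξ h a b) (hu : u ∈ Set.Icc a b)
    (h0 : |(h a).re - c| ≤ M) (hξ : ∀ v ∈ Set.Icc a b, |ξ v - c| ≤ M) :
    |(h u).re - c| ≤ M := by
  rw [abs_le] at *
  constructor
  · have := H.re_ge (M := c - M) hu (by linarith)
      (fun v hv => by have := abs_le.1 (hξ v hv); linarith)
    linarith
  · have := H.re_le (M := c + M) hu (by linarith)
      (fun v hv => by have := abs_le.1 (hξ v hv); linarith)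
    linarith

/-- Growth of the imaginary part when the driver is Lipschitz. -/
lemma RevSol.phase {ξ ξ' : ℝ → ℝ} {h a b K} (H : RevSol ξ h a b) (hab : a ≤ b) (hK : 0 ≤ K)
    (hd : ∀ v ∈ Set.Icc a b, HasDerivAt ξ (ξ' v) v) (hb : ∀ v ∈ Set.Icc a b, |ξ' v| ≤ K) :
    (h a).im ^ 2 - ((h a).re - ξ a) ^ 2 + 4 * (b - a)
      - 2 * (b - a) * K * (|(h a).re - ξ a| + 2 * K * (b - a)) ≤ (h b).im ^ 2 := by
  have hlip : ∀ v ∈ Set.Icc a b, |ξ v - ξ a| ≤ K * (b - a) := by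
    intro v hv
    have := (convex_Icc a b).norm_image_sub_le_of_norm_hasDerivWithin_le
      (fun x hx => (hd x hx).hasDerivWithinAt) (fun x hx => by simpa using hb x hx)
      (Set.left_mem_Icc.2 hab) hv
    simp only [Real.norm_eq_abs] at this
    refine this.trans ?_
    rw [abs_of_nonneg (by linarith [hv.1])]
    exact mul_le_mul_of_nonneg_left (by linarith [hv.2]) hK
  have hba : 0 ≤ b - a := by linarith
  have hX : ∀ v ∈ Set.Icc a b, |(h v).re - ξ v| ≤ |(h a).re - ξ a| + 2 * K * (b - a) := by
    intro v hv
    have h1 := H.abs_re (c := ξ a) (M := |(h a).re - ξ a| + K * (b - a)) hv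
      (by nlinarith) (fun w hw => by have := hlip w hw; have := abs_nonneg ((h a).re - ξ a); linarith)
    have h2 := hlip v hv
    calc |(h v).re - ξ v| = |((h v).re - ξ a) - (ξ v - ξ a)| := by ring_nf
      _ ≤ |(h v).re - ξ a| + |ξ v - ξ a| := abs_sub _ _
      _ ≤ _ := by linarith
  set B := |(h a).re - ξ a| + 2 * K * (b - a) with hB
  have hB0 : 0 ≤ B := (abs_nonneg _).trans (hX a (Set.left_mem_Icc.2 hab))
  have key : MonotoneOn (fun v => (h v).im ^ 2 - ((h v).re - ξ v) ^ 2 - (4 - 2 * K * B) * v)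
      (Set.Icc a b) := by
    have hd' : ∀ u ∈ Set.Icc a b, HasDerivAt
        (fun v => (h v).im ^ 2 - ((h v).re - ξ v) ^ 2 - (4 - 2 * K * B) * v)
        (2 * (h u).im * (2 * (h u).im / sqd ξ h u) -
          2 * ((h u).re - ξ u) * (-2 * ((h u).re - ξ u) / sqd ξ h u - ξ' u) - (4 - 2 * K * B)) u := by
      intro u hu
      have := (((H.hasDeriv_im hu).pow 2).sub
        (((H.hasDeriv_re hu).sub (hd u hu)).pow 2)).sub
        ((hasDerivAt_id u).const_mul (4 - 2 * K * B))
      refine this.congr_deriv ?_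
      simp
    apply monotoneOn_of_deriv_nonneg (convex_Icc a b)
    · intro u hu
      exact (hd' u hu).continuousAt.continuousWithinAt
    · intro u hu
      exact (hd' u (interior_subset hu)).differentiableAt.differentiableWithinAt
    · intro u hu
      have hu' := interior_subset hu
      rw [(hd' u hu').deriv]
      have h1 := H.sqd_pos hu'
      have e : 2 * (h u).im * (2 * (h u).im / sqd ξ h u) -
          2 * ((h u).re - ξ u) * (-2 * ((h u).re - ξ u) / sqd ξ h u - ξ' u) =
          4 + 2 * (((h u).re - ξ u) * ξ' u) := by
        field_simp
        unfold sqd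
        ring
      rw [e]
      have h3 : |((h u).re - ξ u) * ξ' u| ≤ B * K := by
        rw [abs_mul]
        exact mul_le_mul (hX u hu') (hb u hu') (abs_nonneg _) hB0
      have := (abs_le.1 h3).1
      linarith
  have := key (Set.left_mem_Icc.2 hab) (Set.right_mem_Icc.2 hab) hab
  nlinarith [sq_nonneg ((h b).re - ξ b)]

lemma exists_antideriv {q : ℝ → ℝ} {a b : ℝ} (hab : a ≤ b) (hq : ContinuousOn q (Set.Icc a b)) :
    ∃ A : ℝ → ℝ, ∀ u ∈ Set.Icc a b, HasDerivAt A (q u) u := by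
  have hc : Continuous (Set.IccExtend hab ((Set.Icc a b).domRestrict q)) :=
    (continuousOn_iff_continuous_domRestrict.1 hq).Icc_extend'
  refine ⟨fun u => ∫ v in a..u, Set.IccExtend hab ((Set.Icc a b).domRestrict q) v, ?_⟩
  intro u hu
  have := hc.integral_hasStrictDerivAt a u
  rw [Set.IccExtend_of_mem hab _ hu] at this
  exact this.hasDerivAt

lemma RevSol.norm_sq_eq {ξ : ℝ → ℝ} {h : ℝ → ℂ} {u : ℝ} :
    ‖h u - (ξ u : ℂ)‖ ^ 2 = sqd ξ h u := by
  rw [← Complex.normSq_eq_norm_sq, Complex.normSq_apply]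
  simp [sqd, pow_two]

lemma RevSol.hasDeriv_log {ξ h a b u} (H : RevSol ξ h a b) (hu : u ∈ Set.Icc a b) :
    HasDerivAt (fun v => Real.log (h v).im) (2 / sqd ξ h u) u := by
  have h0 := (H u hu).1
  refine ((H.hasDeriv_im hu).log h0.ne').congr_deriv ?_
  have := H.sqd_pos hu
  field_simp

lemma psi_re_le {X1 Y1 X2 Y2 κ : ℝ} (hκ : 0 < κ) (h1 : 0 < Y1) (h2 : 0 < Y2) :
    2 * ((X1 * X2 - Y1 * Y2) / ((X1 ^ 2 + Y1 ^ 2) * (X2 ^ 2 + Y2 ^ 2))) ≤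
      κ / 4 * (4 * X1 ^ 2 / (X1 ^ 2 + Y1 ^ 2) ^ 2) + 1 / (2 * κ) * (2 / (X2 ^ 2 + Y2 ^ 2)) := by
  have hD1 : 0 < X1 ^ 2 + Y1 ^ 2 := by positivity
  have hD2 : 0 < X2 ^ 2 + Y2 ^ 2 := by positivity
  set D1 := X1 ^ 2 + Y1 ^ 2
  set D2 := X2 ^ 2 + Y2 ^ 2 with hD2e
  have e1 : (X1 * X2 - Y1 * Y2) / (D1 * D2) ≤ (X1 / D1) * (X2 / D2) := by
    rw [div_mul_div_comm]
    apply div_le_div_of_nonneg_right _ (by positivity)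
    nlinarith [mul_pos h1 h2]
  have e2 : (X2 / D2) ^ 2 ≤ 1 / D2 := by
    rw [div_pow, div_le_div_iff₀ (by positivity) hD2]
    nlinarith [sq_nonneg Y2]
  have e3 : 2 * ((X1 / D1) * (X2 / D2)) ≤ κ * (X1 / D1) ^ 2 + 1 / κ * (X2 / D2) ^ 2 := by
    have : κ * (X1 / D1) ^ 2 + 1 / κ * (X2 / D2) ^ 2 - 2 * ((X1 / D1) * (X2 / D2)) =
      1 / κ * (κ * (X1 / D1) - X2 / D2) ^ 2 := by
      field_simp
      ring
    have h : 0 ≤ 1 / κ * (κ * (X1 / D1) - X2 / D2) ^ 2 := by positivity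
    linarith
  have e4 : 1 / κ * (X2 / D2) ^ 2 ≤ 1 / κ * (1 / D2) :=
    mul_le_mul_of_nonneg_left e2 (by positivity)
  have e5 : κ / 4 * (4 * X1 ^ 2 / D1 ^ 2) + 1 / (2 * κ) * (2 / D2) =
      κ * (X1 / D1) ^ 2 + 1 / κ * (1 / D2) := by
    field_simp
  rw [e5]
  linarith

set_option maxHeartbeats 2000000 in
/-- The comparison lemma for two reverse flows. -/
lemma compare {ξ₁ ξ₂ : ℝ → ℝ} {h₁ h₂ : ℝ → ℂ} {a b κ ε : ℝ} {A : ℝ → ℝ}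
    (H1 : RevSol ξ₁ h₁ a b) (H2 : RevSol ξ₂ h₂ a b) (hab : a ≤ b) (hκ : 0 < κ)
    (hε : ∀ u ∈ Set.Icc a b, |ξ₁ u - ξ₂ u| ≤ ε)
    (hA : ∀ u ∈ Set.Icc a b, HasDerivAt A (4 * ((h₁ u).re - ξ₁ u) ^ 2 / sqd ξ₁ h₁ u ^ 2) u) :
    ‖h₁ b - h₂ b‖ ≤ Real.exp (κ / 4 * (A b - A a)
        + 1 / (2 * κ) * (Real.log (h₂ b).im - Real.log (h₂ a).im)) *
      (‖h₁ a - h₂ a‖ + ε / 2 * (Real.log (h₁ b).im - Real.log (h₁ a).im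
        + (Real.log (h₂ b).im - Real.log (h₂ a).im))) := by
  have hε0 : 0 ≤ ε := (abs_nonneg _).trans (hε a (Set.left_mem_Icc.2 hab))
  set E : ℝ → ℝ := fun u => κ / 4 * (A u - A a)
        + 1 / (2 * κ) * (Real.log (h₂ u).im - Real.log (h₂ a).im) with hE
  set F : ℝ → ℝ := fun u => ε / 2 * (Real.log (h₁ u).im - Real.log (h₁ a).im
        + (Real.log (h₂ u).im - Real.log (h₂ a).im)) with hF
  set R : ℝ → ℝ := fun u => κ / 4 * (4 * ((h₁ u).re - ξ₁ u) ^ 2 / sqd ξ₁ h₁ u ^ 2)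
        + 1 / (2 * κ) * (2 / sqd ξ₂ h₂ u) with hR
  have hEd : ∀ u ∈ Set.Icc a b, HasDerivAt E (R u) u := fun u hu =>
    (((hA u hu).sub_const _).const_mul _).add (((H2.hasDeriv_log hu).sub_const _).const_mul _)
  have hFd : ∀ u ∈ Set.Icc a b, HasDerivAt F (ε / 2 * (2 / sqd ξ₁ h₁ u + 2 / sqd ξ₂ h₂ u)) u :=
    fun u hu => (((H1.hasDeriv_log hu).sub_const _).add
      ((H2.hasDeriv_log hu).sub_const _)).const_mul _
  have hRn : ∀ u ∈ Set.Icc a b, 0 ≤ R u := by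
    intro u hu
    have := H1.sqd_pos hu
    have := H2.sqd_pos hu
    simp only [hR]
    positivity
  have hEn : ∀ u ∈ Set.Icc a b, 0 ≤ E u := by
    intro u hu
    have : MonotoneOn E (Set.Icc a b) := by
      apply monotoneOn_of_deriv_nonneg (convex_Icc a b)
      · intro u hu
        exact (hEd u hu).continuousAt.continuousWithinAt
      · intro u hu
        exact (hEd u (interior_subset hu)).differentiableAt.differentiableWithinAt
      · intro u hu
        rw [(hEd u (interior_subset hu)).deriv]
        exact hRn u (interior_subset hu)
    have h := this (Set.left_mem_Icc.2 hab) hu hu.1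
    have : E a = 0 := by simp [hE]
    linarith
  have hFn : ∀ u ∈ Set.Icc a b, 0 ≤ F u := by
    intro u hu
    have hl := Set.left_mem_Icc.2 hab
    have h1 := Real.log_le_log (H1 a hl).1 (H1.im_mono hl hu hu.1)
    have h2 := Real.log_le_log (H2 a hl).1 (H2.im_mono hl hu hu.1)
    simp only [hF]
    apply mul_nonneg (by linarith) (by linarith)
  -- perturbed barrier
  have main : ∀ δ : ℝ, 0 < δ → ‖h₁ b - h₂ b‖ ≤
      Real.exp (E b) * (‖h₁ a - h₂ a‖ + δ + δ * (b - a) + F b) := by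
    intro δ hδ
    set G : ℝ → ℝ := fun u => ‖h₁ a - h₂ a‖ + δ + δ * (u - a) + F u with hG
    set B : ℝ → ℝ := fun u => Real.exp (E u) * G u with hB
    have hGpos : ∀ u ∈ Set.Icc a b, 0 < G u := by
      intro u hu
      have := hFn u hu
      have h3 : 0 ≤ δ * (u - a) := mul_nonneg hδ.le (by linarith [hu.1])
      have := norm_nonneg (h₁ a - h₂ a)
      simp only [hG]; linarith
    have hBpos : ∀ u ∈ Set.Icc a b, 0 < B u := fun u hu => mul_pos (Real.exp_pos _) (hGpos u hu)
    have hBd : ∀ u ∈ Set.Icc a b, HasDerivAt B (R u * B u + Real.exp (E u) *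
        (δ + ε / 2 * (2 / sqd ξ₁ h₁ u + 2 / sqd ξ₂ h₂ u))) u := by
      intro u hu
      have hGd : HasDerivAt G (δ + ε / 2 * (2 / sqd ξ₁ h₁ u + 2 / sqd ξ₂ h₂ u)) u := by
        have := ((((hasDerivAt_id u).sub_const a).const_mul δ).const_add
          (‖h₁ a - h₂ a‖ + δ)).add (hFd u hu)
        refine this.congr_deriv ?_
        ring
      refine ((hEd u hu).exp.mul hGd).congr_deriv ?_
      simp only [hB]; ring
    have hHd : ∀ u ∈ Set.Icc a b, HasDerivAt (fun v => h₁ v - h₂ v)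
        (-2 / (h₁ u - (ξ₁ u : ℂ)) - -2 / (h₂ u - (ξ₂ u : ℂ))) u :=
      fun u hu => (H1 u hu).2.sub (H2 u hu).2
    have hle := image_le_of_deriv_right_lt_deriv_boundary' (a := a) (b := b)
      (f := fun v => ‖h₁ v - h₂ v‖ ^ 2)
      (B := fun v => B v ^ 2)
      (fun u hu => (hHd u hu).norm_sq.continuousAt.continuousWithinAt)
      (fun u hu => (hHd u (Set.Ico_subset_Icc_self hu)).norm_sq.hasDerivWithinAt)
      (by
        have : ‖h₁ a - h₂ a‖ ≤ B a := by
          simp only [hB, hG, hE, hF]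
          simp
          linarith
        exact pow_le_pow_left₀ (norm_nonneg _) this 2)
      (fun u hu => ((hBd u hu).pow 2).continuousAt.continuousWithinAt)
      (fun u hu => ((hBd u (Set.Ico_subset_Icc_self hu)).pow 2).hasDerivWithinAt)
      (by
        intro u hu he
        have hu' := Set.Ico_subset_Icc_self hu
        have hBp := hBpos u hu'
        have hnorm : ‖h₁ u - h₂ u‖ = B u :=
          (pow_left_inj₀ (norm_nonneg _) hBp.le two_ne_zero).1 he
        have hD1 := H1.sqd_pos hu'
        have hD2 := H2.sqd_pos hu'
        have hz1 : h₁ u - (ξ₁ u : ℂ) ≠ 0 := by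
          intro h0
          have := RevSol.norm_sq_eq (ξ := ξ₁) (h := h₁) (u := u)
          rw [h0] at this; simp at this; linarith
        have hz2 : h₂ u - (ξ₂ u : ℂ) ≠ 0 := by
          intro h0
          have := RevSol.norm_sq_eq (ξ := ξ₂) (h := h₂) (u := u)
          rw [h0] at this; simp at this; linarith
        set z1 := h₁ u - (ξ₁ u : ℂ) with hz1d
        set z2 := h₂ u - (ξ₂ u : ℂ) with hz2d
        set W := h₁ u - h₂ u with hW
        set ψ : ℂ := 2 / (z1 * z2) with hψ
        have hder : -2 / z1 - -2 / z2 = ψ * (W - ((ξ₁ u - ξ₂ u : ℝ) : ℂ)) := by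
          have : W - ((ξ₁ u - ξ₂ u : ℝ) : ℂ) = z1 - z2 := by
            simp only [hW, hz1d, hz2d]; push_cast; ring
          rw [this, hψ]
          field_simp
          ring
        have hψre : ψ.re ≤ R u := by
          have := psi_re_le (X1 := (h₁ u).re - ξ₁ u) (X2 := (h₂ u).re - ξ₂ u) hκ
            (H1 u hu').1 (H2 u hu').1
          refine le_trans (le_of_eq ?_) this
          have e1 : z1.re = (h₁ u).re - ξ₁ u := by simp [hz1d]
          have e2 : z2.re = (h₂ u).re - ξ₂ u := by simp [hz2d]
          have e3 : z1.im = (h₁ u).im := by simp [hz1d]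
          have e4 : z2.im = (h₂ u).im := by simp [hz2d]
          rw [hψ, Complex.div_re, Complex.normSq_mul, Complex.normSq_apply, Complex.normSq_apply,
            Complex.mul_re, e1, e2, e3, e4]
          simp
          ring
        have hψn : ‖ψ‖ ≤ 1 / 2 * (2 / sqd ξ₁ h₁ u + 2 / sqd ξ₂ h₂ u) := by
          rw [← RevSol.norm_sq_eq, ← RevSol.norm_sq_eq, ← hz1d, ← hz2d, hψ, norm_div, norm_mul]
          have p1 : 0 < ‖z1‖ := norm_pos_iff.2 hz1
          have p2 : 0 < ‖z2‖ := norm_pos_iff.2 hz2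
          have e : 1 / 2 * (2 / ‖z1‖ ^ 2 + 2 / ‖z2‖ ^ 2) - ‖(2:ℂ)‖ / (‖z1‖ * ‖z2‖) =
            (1 / ‖z1‖ - 1 / ‖z2‖) ^ 2 := by
            simp only [Complex.norm_ofNat]
            field_simp
            ring
          have := sq_nonneg (1 / ‖z1‖ - 1 / ‖z2‖)
          linarith
        have hin : inner ℝ W (-2 / z1 - -2 / z2) ≤ R u * B u ^ 2 + B u *
            (ε * (1 / 2 * (2 / sqd ξ₁ h₁ u + 2 / sqd ξ₂ h₂ u))) := by
          rw [hder, mul_sub, inner_sub_right]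
          have e1 : inner ℝ W (ψ * W) = ψ.re * ‖W‖ ^ 2 := by
            rw [Complex.inner, ← Complex.normSq_eq_norm_sq, Complex.normSq_apply]
            simp only [Complex.mul_re, Complex.mul_im, Complex.conj_re, Complex.conj_im]
            ring
          have e2 : |inner ℝ W (ψ * ((ξ₁ u - ξ₂ u : ℝ) : ℂ))| ≤ B u *
            (ε * (1 / 2 * (2 / sqd ξ₁ h₁ u + 2 / sqd ξ₂ h₂ u))) := by
            refine (abs_real_inner_le_norm _ _).trans ?_
            rw [hnorm, norm_mul, Complex.norm_real, Real.norm_eq_abs, mul_comm ‖ψ‖]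
            apply mul_le_mul_of_nonneg_left _ hBp.le
            exact mul_le_mul (hε u hu') hψn (norm_nonneg _) hε0
          have e3 := (abs_le.1 e2).1
          rw [e1, hnorm]
          have : ψ.re * B u ^ 2 ≤ R u * B u ^ 2 := mul_le_mul_of_nonneg_right hψre (by positivity)
          linarith
        have hexp : 1 ≤ Real.exp (E u) := Real.one_le_exp (hEn u hu')
        have hS : 0 < δ + ε / 2 * (2 / sqd ξ₁ h₁ u + 2 / sqd ξ₂ h₂ u) := by positivity
        have h5 : B u * (δ + ε / 2 * (2 / sqd ξ₁ h₁ u + 2 / sqd ξ₂ h₂ u)) ≤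
          B u * (Real.exp (E u) * (δ + ε / 2 * (2 / sqd ξ₁ h₁ u + 2 / sqd ξ₂ h₂ u))) :=
          mul_le_mul_of_nonneg_left (le_mul_of_one_le_left hS.le hexp) hBp.le
        have h6 : 0 < B u * δ := mul_pos hBp hδ
        simp only [Nat.cast_ofNat, Nat.add_one_sub_one, pow_one]
        nlinarith)
    have := hle (Set.right_mem_Icc.2 hab)
    exact (pow_le_pow_iff_left₀ (norm_nonneg _) (hBpos b (Set.right_mem_Icc.2 hab)).le
      two_ne_zero).1 this
  have ht : Tendsto (fun δ : ℝ => Real.exp (E b) * (‖h₁ a - h₂ a‖ + δ + δ * (b - a) + F b))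
      (nhdsWithin 0 (Set.Ioi 0)) (nhds (Real.exp (E b) * (‖h₁ a - h₂ a‖ + 0 + 0 * (b - a) + F b))) := by
    apply Filter.Tendsto.mono_left _ nhdsWithin_le_nhds
    apply Continuous.tendsto
    fun_prop
  have hfin := ge_of_tendsto ht (by
    filter_upwards [self_mem_nhdsWithin] with δ hδ using main δ hδ)
  simp only [add_zero, zero_mul] at hfin
  exact hfin

lemma chain_rev {lam : ℝ → ℝ} (ch : FwdLoewnerChain lam 1) {t : ℝ} (ht : t ∈ Set.Icc (0:ℝ) 1)
    {w : ℂ} (hw : 0 < w.im) :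
    RevSol (fun u => lam (t - u)) (fun u => ch.g (t - u) (ch.finv t w)) 0 t ∧
      ch.g (t - 0) (ch.finv t w) = w ∧ ch.g (t - t) (ch.finv t w) = ch.finv t w := by
  obtain ⟨h1, h2⟩ := ch.finv_maps t ht w hw
  obtain ⟨-, h3, h4⟩ := (ch.mem_H t ht _).1 h1
  refine ⟨?_, by simpa using h2, by simpa using h3⟩
  intro u hu
  have := h4 (t - u) ⟨by linarith [hu.2], by linarith [hu.1]⟩
  refine ⟨this.1, ?_⟩
  have h5 := HasDerivAt.comp_const_sub (f := fun s => ch.g s (ch.finv t w)) t u this.2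
  refine h5.congr_deriv ?_
  ring

lemma RevSol.ge_norm {ξ h a b u} (H : RevSol ξ h a b) (hu : u ∈ Set.Icc a b) {y : ℝ}
    (hy : y ≤ (h a).im) : y ≤ ‖h u - (ξ u : ℂ)‖ := by
  have h1 := H.im_mono (Set.left_mem_Icc.2 (hu.1.trans hu.2)) hu hu.1
  have h2 := Complex.abs_im_le_norm (h u - (ξ u : ℂ))
  have h3 := le_abs_self (h u - (ξ u : ℂ)).im
  have h4 : (h u - (ξ u : ℂ)).im = (h u).im := by simp
  rw [h4] at h2 h3
  linarith

/-- Two flows with the same driver: lower bound on the expansion. -/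
lemma grow {ξ : ℝ → ℝ} {h k : ℝ → ℂ} {t y : ℝ} {Q : ℝ → ℝ} (ht : 0 ≤ t) (hy : 0 < y)
    (H : RevSol ξ h 0 t) (K : RevSol ξ k 0 t) (hh : y ≤ (h 0).im) (hk : y ≤ (k 0).im)
    (hQ : ∀ u ∈ Set.Icc 0 t, HasDerivAt Q ((2 / (h u - (ξ u : ℂ)) ^ 2).re) u) :
    ‖k 0 - h 0‖ * Real.exp (Q t - Q 0
      - (2 * (‖k 0 - h 0‖ * Real.exp (2 / y ^ 2 * t)) / y ^ 3) * t) ≤ ‖k t - h t‖ := by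
  have hHd : ∀ u ∈ Set.Icc 0 t, HasDerivAt (fun v => k v - h v)
      (2 / ((h u - (ξ u : ℂ)) * (k u - (ξ u : ℂ))) * (k u - h u)) u := by
    intro u hu
    refine ((K u hu).2.sub (H u hu).2).congr_deriv ?_
    have p1 : h u - (ξ u : ℂ) ≠ 0 := norm_pos_iff.1 (hy.trans_le (H.ge_norm hu hh))
    have p2 : k u - (ξ u : ℂ) ≠ 0 := norm_pos_iff.1 (hy.trans_le (K.ge_norm hu hk))
    field_simp
    ring
  have hfd : ∀ u ∈ Set.Icc 0 t, HasDerivAt (fun v => ‖k v - h v‖ ^ 2)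
      (2 * ((2 / ((h u - (ξ u : ℂ)) * (k u - (ξ u : ℂ)))).re * ‖k u - h u‖ ^ 2)) u := by
    intro u hu
    refine (hHd u hu).norm_sq.congr_deriv ?_
    congr 1
    rw [Complex.inner, ← Complex.normSq_eq_norm_sq, Complex.normSq_apply]
    simp only [Complex.mul_re, Complex.mul_im, Complex.conj_re, Complex.conj_im]
    ring
  have hψ : ∀ u ∈ Set.Icc 0 t, ‖2 / ((h u - (ξ u : ℂ)) * (k u - (ξ u : ℂ)))‖ ≤ 2 / y ^ 2 := by
    intro u hu
    rw [norm_div, norm_mul, Complex.norm_ofNat, pow_two]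
    gcongr
    · exact H.ge_norm hu hh
    · exact K.ge_norm hu hk
  -- upper bound
  have hup : ∀ u ∈ Set.Icc 0 t, ‖k u - h u‖ ≤ ‖k 0 - h 0‖ * Real.exp (2 / y ^ 2 * t) := by
    intro u hu
    have hd : ∀ u ∈ Set.Icc 0 t, HasDerivAt
        (fun v => ‖k v - h v‖ ^ 2 * Real.exp (-(4 / y ^ 2) * v))
        ((2 * ((2 / ((h u - (ξ u : ℂ)) * (k u - (ξ u : ℂ)))).re * ‖k u - h u‖ ^ 2)) *
          Real.exp (-(4 / y ^ 2) * u) +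
          ‖k u - h u‖ ^ 2 * (Real.exp (-(4 / y ^ 2) * u) * (-(4 / y ^ 2) * 1))) u :=
      fun u hu => (hfd u hu).mul (((hasDerivAt_id u).const_mul _).exp)
    have : AntitoneOn (fun v => ‖k v - h v‖ ^ 2 * Real.exp (-(4 / y ^ 2) * v)) (Set.Icc 0 t) := by
      apply antitoneOn_of_deriv_nonpos (convex_Icc 0 t)
      · intro u hu
        exact (hd u hu).continuousAt.continuousWithinAt
      · intro u hu
        exact (hd u (interior_subset hu)).differentiableAt.differentiableWithinAt
      · intro u hu
        have hu' := interior_subset hu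
        rw [(hd u hu').deriv]
        have h1 := (Complex.re_le_norm _).trans (hψ u hu')
        have h2 : 0 ≤ ‖k u - h u‖ ^ 2 * Real.exp (-(4 / y ^ 2) * u) := by positivity
        have h3 := mul_nonneg (sub_nonneg.2 h1) h2
        have e : (4 / y ^ 2) = 2 * (2 / y ^ 2) := by ring
        rw [e] at h3 ⊢
        nlinarith
    have h1 := this (Set.left_mem_Icc.2 ht) hu hu.1
    simp only [mul_zero, Real.exp_zero, mul_one] at h1
    have h2 : ‖k u - h u‖ ^ 2 ≤ (‖k 0 - h 0‖ * Real.exp (2 / y ^ 2 * u)) ^ 2 := by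
      have e : Real.exp (-(4 / y ^ 2) * u) * Real.exp (2 / y ^ 2 * u) ^ 2 = 1 := by
        rw [← Real.exp_nat_mul, ← Real.exp_add, ← Real.exp_zero]
        congr 1
        push_cast; ring
      calc ‖k u - h u‖ ^ 2 = (‖k u - h u‖ ^ 2 * Real.exp (-(4 / y ^ 2) * u)) *
            Real.exp (2 / y ^ 2 * u) ^ 2 := by rw [mul_assoc, e, mul_one]
        _ ≤ ‖k 0 - h 0‖ ^ 2 * Real.exp (2 / y ^ 2 * u) ^ 2 := by gcongr
        _ = _ := by ring
    have h3 := (pow_le_pow_iff_left₀ (norm_nonneg _) (by positivity) two_ne_zero).1 h2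
    refine h3.trans ?_
    gcongr
    exact hu.2
  set δ := 2 * (‖k 0 - h 0‖ * Real.exp (2 / y ^ 2 * t)) / y ^ 3 with hδ
  have hre : ∀ u ∈ Set.Icc 0 t, (2 / (h u - (ξ u : ℂ)) ^ 2).re - δ ≤
      (2 / ((h u - (ξ u : ℂ)) * (k u - (ξ u : ℂ)))).re := by
    intro u hu
    have g1 := H.ge_norm hu hh
    have g2 := K.ge_norm hu hk
    have p1 : h u - (ξ u : ℂ) ≠ 0 := norm_pos_iff.1 (hy.trans_le g1)
    have p2 : k u - (ξ u : ℂ) ≠ 0 := norm_pos_iff.1 (hy.trans_le g2)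
    have e : 2 / (h u - (ξ u : ℂ)) ^ 2 - 2 / ((h u - (ξ u : ℂ)) * (k u - (ξ u : ℂ))) =
        2 * (k u - h u) / ((h u - (ξ u : ℂ)) ^ 2 * (k u - (ξ u : ℂ))) := by
      field_simp
      ring
    have hn : ‖2 / (h u - (ξ u : ℂ)) ^ 2 - 2 / ((h u - (ξ u : ℂ)) * (k u - (ξ u : ℂ)))‖ ≤ δ := by
      rw [e, norm_div, norm_mul, norm_mul, norm_pow, Complex.norm_ofNat, hδ]
      have : y ^ 3 ≤ ‖h u - (ξ u : ℂ)‖ ^ 2 * ‖k u - (ξ u : ℂ)‖ := by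
        rw [pow_succ]
        gcongr
      have := hup u hu
      gcongr
    have := (Complex.re_le_norm _).trans hn
    rw [Complex.sub_re] at this
    linarith
  have hd : ∀ u ∈ Set.Icc 0 t, HasDerivAt
      (fun v => ‖k v - h v‖ ^ 2 * Real.exp (-2 * (Q v - δ * v)))
      ((2 * ((2 / ((h u - (ξ u : ℂ)) * (k u - (ξ u : ℂ)))).re * ‖k u - h u‖ ^ 2)) *
        Real.exp (-2 * (Q u - δ * u)) +
        ‖k u - h u‖ ^ 2 * (Real.exp (-2 * (Q u - δ * u)) *
          (-2 * ((2 / (h u - (ξ u : ℂ)) ^ 2).re - δ * 1)))) u :=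
    fun u hu => (hfd u hu).mul
      ((((hQ u hu).sub ((hasDerivAt_id u).const_mul δ)).const_mul (-2)).exp)
  have hm : MonotoneOn (fun v => ‖k v - h v‖ ^ 2 * Real.exp (-2 * (Q v - δ * v)))
      (Set.Icc 0 t) := by
    apply monotoneOn_of_deriv_nonneg (convex_Icc 0 t)
    · intro u hu
      exact (hd u hu).continuousAt.continuousWithinAt
    · intro u hu
      exact (hd u (interior_subset hu)).differentiableAt.differentiableWithinAt
    · intro u hu
      have hu' := interior_subset hu
      rw [(hd u hu').deriv]
      have h1 := hre u hu'
      have h2 : 0 ≤ ‖k u - h u‖ ^ 2 * Real.exp (-2 * (Q u - δ * u)) := by positivity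
      have h3 := mul_nonneg (sub_nonneg.2 h1) h2
      nlinarith
  have h1 := hm (Set.left_mem_Icc.2 ht) (Set.right_mem_Icc.2 ht) ht
  simp only [mul_zero, sub_zero] at h1
  have h2 : (‖k 0 - h 0‖ * Real.exp (Q t - Q 0 - δ * t)) ^ 2 ≤ ‖k t - h t‖ ^ 2 := by
    have e1 : Real.exp (Q t - Q 0 - δ * t) ^ 2 =
        Real.exp (-2 * Q 0) * Real.exp (2 * (Q t - δ * t)) := by
      rw [← Real.exp_nat_mul, ← Real.exp_add]
      congr 1
      push_cast; ring
    have e2 : Real.exp (-2 * (Q t - δ * t)) * Real.exp (2 * (Q t - δ * t)) = 1 := by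
      rw [← Real.exp_add, ← Real.exp_zero]
      congr 1
      ring
    calc (‖k 0 - h 0‖ * Real.exp (Q t - Q 0 - δ * t)) ^ 2
        = (‖k 0 - h 0‖ ^ 2 * Real.exp (-2 * Q 0)) * Real.exp (2 * (Q t - δ * t)) := by
          rw [mul_pow, e1]; ring
      _ ≤ (‖k t - h t‖ ^ 2 * Real.exp (-2 * (Q t - δ * t))) * Real.exp (2 * (Q t - δ * t)) := by
          gcongr
      _ = _ := by rw [mul_assoc, e2, mul_one]
  exact (pow_le_pow_iff_left₀ (by positivity) (norm_nonneg _) two_ne_zero).1 h2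

lemma isOpen_UHP : IsOpen UHP := isOpen_lt continuous_const Complex.continuous_im

lemma fhat_hasDerivAt {lam : ℝ → ℝ} (ch : FwdLoewnerChain lam 1) {t : ℝ}
    (ht : t ∈ Set.Icc (0:ℝ) 1) {y : ℝ} (hy : 0 < y) :
    HasDerivAt (fun z => ch.finv t (z + (lam t : ℂ)))
      (deriv (fun z => ch.finv t (z + (lam t : ℂ))) ((y : ℂ) * Complex.I)) ((y : ℂ) * Complex.I) := by
  apply DifferentiableAt.hasDerivAt
  have h1 : (y : ℂ) * Complex.I + (lam t : ℂ) ∈ UHP := by simp [UHP, hy]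
  have h2 := (ch.finv_holo t ht).differentiableAt (isOpen_UHP.mem_nhds h1)
  exact DifferentiableAt.comp (g := ch.finv t) (f := fun z : ℂ => z + (lam t : ℂ)) _ h2
    (by fun_prop)

lemma fhat_hasDerivAt_real {lam : ℝ → ℝ} (ch : FwdLoewnerChain lam 1) {t : ℝ}
    (ht : t ∈ Set.Icc (0:ℝ) 1) {y : ℝ} (hy : 0 < y) :
    HasDerivAt (fun r : ℝ => ch.finv t ((lam t : ℂ) + r * Complex.I))
      (Complex.I * deriv (fun z => ch.finv t (z + (lam t : ℂ))) ((y : ℂ) * Complex.I)) y := by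
  have h1 := fhat_hasDerivAt ch ht hy
  have h2 : HasDerivAt (fun r : ℝ => (r : ℂ) * Complex.I) Complex.I y := by
    simpa using (Complex.ofRealCLM.hasDerivAt (x := y)).mul_const Complex.I
  have h3 := h1.scomp y h2
  have e : (fun r : ℝ => ch.finv t ((lam t : ℂ) + r * Complex.I)) =
      (fun z => ch.finv t (z + (lam t : ℂ))) ∘ (fun r : ℝ => (r : ℂ) * Complex.I) := by
    funext r
    simp [add_comm]
  rw [e]
  simpa using h3

/-- Lower bound for the derivative of the inverse map in terms of the flow. -/
lemma deriv_lower {lam : ℝ → ℝ} (ch : FwdLoewnerChain lam 1) {t : ℝ}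
    (ht : t ∈ Set.Icc (0:ℝ) 1) {y : ℝ} (hy : 0 < y) {h : ℝ → ℂ}
    (hh : h = fun u => ch.g (t - u) (ch.finv t ((lam t : ℂ) + y * Complex.I))) {A : ℝ → ℝ}
    (hA : ∀ u ∈ Set.Icc 0 t, HasDerivAt A
      (4 * ((h u).re - lam (t - u)) ^ 2 / sqd (fun u => lam (t - u)) h u ^ 2) u) {D : ℝ}
    (hD : ‖deriv (fun z => ch.finv t (z + (lam t : ℂ))) ((y : ℂ) * Complex.I)‖ ≤ D) :
    A t - A 0 ≤ Real.log D + Real.log (h t).im - Real.log y := by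
  have hw : 0 < ((lam t : ℂ) + y * Complex.I).im := by simp [hy]
  obtain ⟨H, h0, h1⟩ := chain_rev ch ht hw
  have h0' : h 0 = (lam t : ℂ) + y * Complex.I := by rw [hh]; exact h0
  have h1' : h t = ch.finv t ((lam t : ℂ) + y * Complex.I) := by rw [hh]; exact h1
  rw [← hh] at H
  set d := deriv (fun z => ch.finv t (z + (lam t : ℂ))) ((y : ℂ) * Complex.I) with hd
  have him0 : (h 0).im = y := by rw [h0']; simp
  set Q : ℝ → ℝ := fun u => A u - Real.log (h u).im with hQdef
  have hQ : ∀ u ∈ Set.Icc 0 t, HasDerivAt Q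
      ((2 / (h u - ((fun u => lam (t - u)) u : ℂ)) ^ 2).re) u := by
    intro u hu
    refine ((hA u hu).sub (H.hasDeriv_log hu)).congr_deriv ?_
    have hDp := H.sqd_pos hu
    have hn := RevSol.norm_sq_eq (ξ := fun u => lam (t - u)) (h := h) (u := u)
    rw [Complex.div_re, map_pow, Complex.normSq_eq_norm_sq, hn]
    have : ((h u - (lam (t - u) : ℂ)) ^ 2).re = ((h u).re - lam (t - u)) ^ 2 - (h u).im ^ 2 := by
      simp [pow_two]
    simp only [this]
    field_simp
    simp [sqd]
    ring
  have hev : ∀ e : ℝ, 0 < e → Real.exp (Q t - Q 0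
      - (2 * (e * Real.exp (2 / y ^ 2 * t)) / y ^ 3) * t) ≤
      ‖e⁻¹ • (ch.finv t ((lam t : ℂ) + (y + e : ℝ) * Complex.I) -
        ch.finv t ((lam t : ℂ) + y * Complex.I))‖ := by
    intro e he
    have hw' : 0 < ((lam t : ℂ) + (y + e : ℝ) * Complex.I).im := by simp; linarith
    obtain ⟨K, k0, k1⟩ := chain_rev ch ht hw'
    have g := grow ht.1 hy H K him0.ge (by
      simp only [k0]; simp; linarith) hQ
    simp only [k0, k1, h0', h1'] at g
    have e1 : ‖(lam t : ℂ) + (y + e : ℝ) * Complex.I - ((lam t : ℂ) + y * Complex.I)‖ = e := by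
      have : (lam t : ℂ) + (y + e : ℝ) * Complex.I - ((lam t : ℂ) + y * Complex.I) =
        (e : ℂ) * Complex.I := by push_cast; ring
      rw [this]; simp [he.le]
    rw [e1] at g
    rw [norm_smul, norm_inv, Real.norm_eq_abs, abs_of_pos he, inv_mul_eq_div, le_div_iff₀ he,
      mul_comm]
    exact g
  have hslope := (hasDerivAt_iff_tendsto_slope_zero.1 (fhat_hasDerivAt_real ch ht hy)).norm
  have hslope' : Tendsto _ (nhdsWithin 0 (Set.Ioi (0:ℝ))) _ := hslope.mono_left
    (nhdsWithin_mono _ (fun x hx => ne_of_gt hx))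
  have hl : Tendsto (fun e : ℝ => Real.exp (Q t - Q 0
      - (2 * (e * Real.exp (2 / y ^ 2 * t)) / y ^ 3) * t)) (nhdsWithin 0 (Set.Ioi (0:ℝ)))
      (nhds (Real.exp (Q t - Q 0 - (2 * (0 * Real.exp (2 / y ^ 2 * t)) / y ^ 3) * t))) := by
    apply Filter.Tendsto.mono_left _ nhdsWithin_le_nhds
    apply Continuous.tendsto
    fun_prop
  have hle := le_of_tendsto_of_tendsto hl hslope' (by
    filter_upwards [self_mem_nhdsWithin] with e he using hev e he)
  rw [norm_mul, Complex.norm_I, one_mul, ← hd] at hle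
  simp only [zero_mul, mul_zero, zero_div, sub_zero] at hle
  replace hle := hle.trans hD
  have := (Real.le_log_iff_exp_le (lt_of_lt_of_le (Real.exp_pos _) hle)).2 hle
  simp only [hQdef, him0] at this
  linarith

/-- Distance from the tip along the hyperbolic geodesic. -/
lemma tip_dist {lam : ℝ → ℝ} (ch : FwdLoewnerChain lam 1) {γ : ℝ → ℂ} (hγ : HasTrace lam 1 ch γ)
    {c₀ β y₀ : ℝ} (hc₀ : 0 < c₀) (hβ1 : β < 1) {t : ℝ}
    (ht : t ∈ Set.Icc (0:ℝ) 1)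
    (hd : ∀ y : ℝ, 0 < y → y ≤ y₀ →
            ‖deriv (fun z => ch.finv t (z + (lam t : ℂ))) ((y : ℂ) * Complex.I)‖
              ≤ c₀ * y ^ (-β)) {y : ℝ} (hy : 0 < y) (hyy : y ≤ y₀) :
    ‖ch.finv t ((lam t : ℂ) + y * Complex.I) - γ t‖ ≤ c₀ / (1 - β) * y ^ (1 - β) := by
  have h1β : 0 < 1 - β := by linarith
  have key : ∀ η : ℝ, 0 < η → η ≤ y → ‖ch.finv t ((lam t : ℂ) + y * Complex.I) -
      ch.finv t ((lam t : ℂ) + η * Complex.I)‖ ≤ c₀ / (1 - β) * y ^ (1 - β) := by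
    intro η hη hηy
    have hB : ∀ x : ℝ, 0 < x → HasDerivAt (fun r : ℝ => c₀ / (1 - β) * r ^ (1 - β))
        (c₀ * x ^ (-β)) x := by
      intro x hx
      refine ((Real.hasDerivAt_rpow_const (p := 1 - β) (Or.inl hx.ne')).const_mul
        (c₀ / (1 - β))).congr_deriv ?_
      have : 1 - β - 1 = -β := by ring
      rw [this]
      field_simp
    have := image_norm_le_of_norm_deriv_right_le_deriv_boundary' (a := η) (b := y)
      (f := fun r : ℝ => ch.finv t ((lam t : ℂ) + r * Complex.I) -
        ch.finv t ((lam t : ℂ) + η * Complex.I))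
      (B := fun r : ℝ => c₀ / (1 - β) * r ^ (1 - β))
      (fun x hx => ((fhat_hasDerivAt_real ch ht
        (hη.trans_le hx.1)).sub_const _).continuousAt.continuousWithinAt)
      (fun x hx => ((fhat_hasDerivAt_real ch ht
        (hη.trans_le hx.1)).sub_const _).hasDerivWithinAt)
      (by simp only [sub_self, norm_zero]; positivity)
      (fun x hx => (hB x (hη.trans_le hx.1)).continuousAt.continuousWithinAt)
      (fun x hx => (hB x (hη.trans_le hx.1)).hasDerivWithinAt)
      (by
        intro x hx
        rw [norm_mul, Complex.norm_I, one_mul]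
        exact hd x (hη.trans_le hx.1) (hx.2.le.trans hyy))
    exact this (Set.right_mem_Icc.2 hηy)
  have hlim := ((hγ.2 t ht).const_sub (ch.finv t ((lam t : ℂ) + y * Complex.I))).norm
  refine le_of_tendsto hlim ?_
  filter_upwards [Ioo_mem_nhdsGT hy] with η hη using key η hη.1 hη.2.le

lemma RevSol.congr {ξ ξ' : ℝ → ℝ} {h a b} (H : RevSol ξ h a b)
    (he : ∀ u ∈ Set.Icc a b, ξ u = ξ' u) : RevSol ξ' h a b := by
  intro u hu
  rw [← he u hu]
  exact H u hu

/-- Growth under a square-root driver: general estimate. -/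
lemma phase_sqrt {A B C a ρ s : ℝ} {h : ℝ → ℂ} (hρ : 0 < ρ) (hA : |A| ≤ C) (hs : 0 ≤ s)
    (hsρ : s ≤ ρ / 2)
    (H : RevSol (fun u => A * Real.sqrt (a + ρ - u) + B) h a (a + ρ)) :
    (h a).im ^ 2 - ((h a).re - (A * Real.sqrt ρ + B)) ^ 2 + 4 * s
      - 2 * s * (C / Real.sqrt ρ) * (|(h a).re - (A * Real.sqrt ρ + B)|
        + 2 * (C / Real.sqrt ρ) * s) ≤ (h (a + ρ)).im ^ 2 := by
  have hC : 0 ≤ C := (abs_nonneg _).trans hA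
  have hsq : 0 < Real.sqrt ρ := Real.sqrt_pos.2 hρ
  have H1 := H.mono (a' := a) (b' := a + s) le_rfl (by linarith)
  have hp := H1.phase (K := C / Real.sqrt ρ)
    (ξ' := fun u => A * (-1 / (2 * Real.sqrt (a + ρ - u)))) (by linarith) (by positivity)
    (by
      intro v hv
      have hpos : 0 < a + ρ - v := by linarith [hv.2]
      have h1 : HasDerivAt (fun u : ℝ => a + ρ - u) (-1) v := by
        simpa using (hasDerivAt_id v).const_sub (a + ρ)
      exact ((h1.sqrt hpos.ne').const_mul A).add_const B)
    (by
      intro v hv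
      have hpos : ρ / 2 ≤ a + ρ - v := by linarith [hv.2]
      have h2 : Real.sqrt ρ / 2 ≤ Real.sqrt (a + ρ - v) := by
        apply Real.le_sqrt_of_sq_le
        rw [div_pow, Real.sq_sqrt hρ.le]
        linarith
      have h3 : 0 < Real.sqrt (a + ρ - v) := by linarith [half_pos hsq]
      rw [abs_mul, abs_div, abs_neg, abs_one, abs_of_pos (by positivity : 0 < 2 * √(a + ρ - v)),
        mul_one_div]
      apply div_le_div₀ hC hA hsq
      linarith)
  have e : a + ρ - a = ρ := by ring
  have e' : a + s - a = s := by ring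
  simp only [e, e'] at hp
  refine hp.trans ?_
  have hm := H.im_mono (a := a) (b := a + ρ) (show a + s ∈ Set.Icc a (a + ρ) from
    ⟨by linarith, by linarith⟩) (Set.right_mem_Icc.2 (by linarith)) (by linarith)
  have hp := (H (a + s) ⟨by linarith, by linarith⟩).1
  exact pow_le_pow_left₀ hp.le hm 2

lemma phase_one {A B C a ρ : ℝ} {h : ℝ → ℂ} (hρ : 0 < ρ) (hA : |A| ≤ C) (hC : 1 ≤ C)
    (H : RevSol (fun u => A * Real.sqrt (a + ρ - u) + B) h a (a + ρ))
    (h0 : (h a).re = A * Real.sqrt ρ + B) :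
    Real.sqrt ρ / C ≤ (h (a + ρ)).im ∧ |(h (a + ρ)).re - B| ≤ 2 * C * Real.sqrt ρ := by
  have hsq : 0 < Real.sqrt ρ := Real.sqrt_pos.2 hρ
  have hC0 : 0 < C := by linarith
  constructor
  · have h1 := phase_sqrt (s := ρ / (2 * C ^ 2)) hρ hA (by positivity)
      (by
        apply div_le_div_of_nonneg_left hρ.le (by norm_num)
        nlinarith) H
    rw [h0] at h1
    simp only [sub_self, abs_zero] at h1
    have hp := (H (a + ρ) ⟨by linarith, le_rfl⟩).1
    apply le_of_sq_le_sq _ hp.le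
    rw [div_pow, Real.sq_sqrt hρ.le]
    have e : 2 * (ρ / (2 * C ^ 2)) * (C / Real.sqrt ρ) * (0 + 2 * (C / Real.sqrt ρ) *
      (ρ / (2 * C ^ 2))) = ρ / C ^ 2 := by
      have : Real.sqrt ρ ^ 2 = ρ := Real.sq_sqrt hρ.le
      field_simp
      rw [this]
      ring
    rw [e] at h1
    have e2 : 4 * (ρ / (2 * C ^ 2)) = 2 * (ρ / C ^ 2) := by field_simp; norm_num
    rw [e2] at h1
    nlinarith [sq_nonneg (h a).im]
  · have := H.abs_re (u := a + ρ) (c := A * Real.sqrt ρ + B) (M := C * Real.sqrt ρ)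
      ⟨by linarith, le_rfl⟩ (by rw [h0, sub_self, abs_zero]; positivity)
      (by
        intro v hv
        have e : A * Real.sqrt (a + ρ - v) + B - (A * Real.sqrt ρ + B) =
          A * (Real.sqrt (a + ρ - v) - Real.sqrt ρ) := by ring
        rw [e, abs_mul]
        apply mul_le_mul hA _ (abs_nonneg _) hC0.le
        have h1 := Real.sqrt_nonneg (a + ρ - v)
        have h2 : Real.sqrt (a + ρ - v) ≤ Real.sqrt ρ := Real.sqrt_le_sqrt (by linarith [hv.1])
        rw [abs_le]; constructor <;> linarith)
    have h3 : |A * Real.sqrt ρ| ≤ C * Real.sqrt ρ := by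
      rw [abs_mul, abs_of_pos hsq]; gcongr
    calc |(h (a + ρ)).re - B| = |((h (a + ρ)).re - (A * Real.sqrt ρ + B)) + A * Real.sqrt ρ| := by
          ring_nf
      _ ≤ _ := abs_add_le _ _
      _ ≤ _ := by linarith

lemma phase_two {A B C a ρ : ℝ} {h : ℝ → ℂ} (hρ : 0 < ρ) (hA : |A| ≤ C) (hC : 1 ≤ C)
    (H : RevSol (fun u => A * Real.sqrt (a + ρ - u) + B) h a (a + ρ))
    (h0 : |(h a).re - (A * Real.sqrt ρ + B)| ≤ 2 * C ^ 2 * (h a).im) :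
    Real.sqrt ρ / (6 * C ^ 3) ≤ (h (a + ρ)).im := by
  have hsq : 0 < Real.sqrt ρ := Real.sqrt_pos.2 hρ
  have hC0 : 0 < C := by linarith
  have hC2 : 1 ≤ C ^ 2 := one_le_pow₀ hC
  have hp := (H (a + ρ) ⟨by linarith, le_rfl⟩).1
  have hpa := (H a ⟨le_rfl, by linarith⟩).1
  set r := Real.sqrt ρ / (3 * C) with hr
  have hr0 : 0 < r := by positivity
  have h1 := phase_sqrt (s := r ^ 2) hρ hA (by positivity)
    (by
      rw [hr, div_pow, Real.sq_sqrt hρ.le]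
      apply div_le_div_of_nonneg_left hρ.le (by norm_num)
      nlinarith) H
  have hK : C / Real.sqrt ρ = 1 / (3 * r) := by
    rw [hr]; field_simp
  rw [hK] at h1
  set X := |(h a).re - (A * Real.sqrt ρ + B)| with hX
  have hXs : ((h a).re - (A * Real.sqrt ρ + B)) ^ 2 = X ^ 2 := (sq_abs _).symm
  rw [hXs] at h1
  have e : 2 * r ^ 2 * (1 / (3 * r)) * (X + 2 * (1 / (3 * r)) * r ^ 2) =
      2 / 3 * r * X + 4 / 9 * r ^ 2 := by
    field_simp
    ring
  rw [e] at h1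
  have hfin : r / (2 * C ^ 2) ≤ (h (a + ρ)).im := by
    by_cases hc : X ≤ r
    · have h2 : r ^ 2 ≤ (h (a + ρ)).im ^ 2 := by
        have hX0 : 0 ≤ X := abs_nonneg _
        nlinarith [sq_nonneg (h a).im]
      have h3 := (pow_le_pow_iff_left₀ hr0.le hp.le two_ne_zero).1 h2
      refine le_trans ?_ h3
      apply div_le_self hr0.le
      linarith
    · push Not at hc
      have hm := H.im_mono (Set.left_mem_Icc.2 (by linarith)) (Set.right_mem_Icc.2 (by linarith))
        (by linarith : a ≤ a + ρ)
      refine le_trans ?_ hm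
      rw [div_le_iff₀ (by positivity)]
      simp only
      linarith
  refine le_trans (le_of_eq ?_) hfin
  rw [hr]; field_simp; norm_num

lemma interp_formula (lam : ℝ → ℝ) {n : ℕ} (hn : 1 ≤ n) (k : ℕ) {t : ℝ}
    (h1 : (k : ℝ) / n ≤ t) (h2 : t ≤ ((k : ℝ) + 1) / n) :
    sqrtInterp lam n t = Real.sqrt n * (lam (((k : ℝ) + 1) / n) - lam ((k : ℝ) / n)) *
      Real.sqrt (t - (k : ℝ) / n) + lam ((k : ℝ) / n) := by
  have hn0 : (0 : ℝ) < n := by exact_mod_cast hn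
  rcases h2.lt_or_eq with h | h
  · have : ⌊t * (n:ℝ)⌋₊ = k := by
      rw [div_le_iff₀ hn0] at h1
      rw [lt_div_iff₀ hn0] at h
      rw [Nat.floor_eq_iff ((Nat.cast_nonneg k).trans h1)]
      exact ⟨h1, h⟩
    rw [sqrtInterp, this]
  · have : ⌊t * (n:ℝ)⌋₊ = k + 1 := by
      rw [h, div_mul_cancel₀ _ hn0.ne']
      exact_mod_cast Nat.floor_natCast (k + 1)
    rw [sqrtInterp, this, h]
    have e : ((k : ℝ) + 1) / n - (k : ℝ) / n = 1 / n := by ring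
    have e2 : Real.sqrt n * Real.sqrt (1 / n) = 1 := by
      rw [← Real.sqrt_mul hn0.le, mul_one_div_cancel hn0.ne', Real.sqrt_one]
    push_cast
    rw [sub_self, Real.sqrt_zero, e]
    linear_combination (-(lam (((k : ℝ) + 1) / n) - lam ((k : ℝ) / n))) * e2

lemma interp_coef {lam : ℝ → ℝ} {n : ℕ} (hn : 1 ≤ n) {C : ℝ}
    (hosc : ∀ s ∈ Set.Icc (0:ℝ) 1, ∀ t ∈ Set.Icc (0:ℝ) 1, |t - s| ≤ 1 / n →
      |lam t - lam s| ≤ C / Real.sqrt n) {k : ℕ} (hk : k < n) :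
    |Real.sqrt n * (lam (((k : ℝ) + 1) / n) - lam ((k : ℝ) / n))| ≤ C := by
  have hn0 : (0 : ℝ) < n := by exact_mod_cast hn
  have hk' : (k : ℝ) + 1 ≤ n := by exact_mod_cast hk
  have hsn : 0 < Real.sqrt n := Real.sqrt_pos.2 hn0
  have h := hosc ((k : ℝ) / n) ⟨by positivity, by rw [div_le_one hn0]; linarith⟩
    (((k : ℝ) + 1) / n) ⟨by positivity, by rw [div_le_one hn0]; linarith⟩ (by
      have e : ((k : ℝ) + 1) / n - (k : ℝ) / n = 1 / n := by ring
      rw [e, abs_of_pos (by positivity)])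
  rw [abs_mul, abs_of_pos hsn]
  rw [le_div_iff₀ hsn] at h
  linarith

lemma floor_facts {n : ℕ} (hn : 1 ≤ n) {t : ℝ} (ht : t ∈ Set.Icc (0:ℝ) 1) :
    ((⌊t * (n:ℝ)⌋₊ : ℕ) : ℝ) / n ≤ t ∧ t < (((⌊t * (n:ℝ)⌋₊ : ℕ) : ℝ) + 1) / n := by
  have hn0 : (0 : ℝ) < n := by exact_mod_cast hn
  rw [div_le_iff₀ hn0, lt_div_iff₀ hn0]
  exact ⟨Nat.floor_le (mul_nonneg ht.1 hn0.le), Nat.lt_floor_add_one _⟩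

lemma interp_close {lam : ℝ → ℝ} {n : ℕ} (hn : 1 ≤ n) {C : ℝ}
    (hosc : ∀ s ∈ Set.Icc (0:ℝ) 1, ∀ t ∈ Set.Icc (0:ℝ) 1, |t - s| ≤ 1 / n →
      |lam t - lam s| ≤ C / Real.sqrt n) {t : ℝ} (ht : t ∈ Set.Icc (0:ℝ) 1) :
    |lam t - sqrtInterp lam n t| ≤ 2 * (C / Real.sqrt n) := by
  have hn0 : (0 : ℝ) < n := by exact_mod_cast hn
  have hsn : 0 < Real.sqrt n := Real.sqrt_pos.2 hn0
  obtain ⟨f1, f2⟩ := floor_facts hn ht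
  set k := ⌊t * (n:ℝ)⌋₊ with hk
  have hf := interp_formula lam hn k f1 f2.le
  have e : ((k : ℝ) + 1) / n = (k : ℝ) / n + 1 / n := by ring
  have hk1 : (k : ℝ) / n ∈ Set.Icc (0:ℝ) 1 := ⟨by positivity, f1.trans ht.2⟩
  have h1 := hosc _ hk1 t ht (by rw [abs_of_nonneg (by linarith)]; linarith)
  have h2 : |Real.sqrt n * (lam (((k : ℝ) + 1) / n) - lam ((k : ℝ) / n)) *
      Real.sqrt (t - (k : ℝ) / n)| ≤ C / Real.sqrt n := by
    rcases f1.lt_or_eq with h | h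
    · have hkn : k < n := by
        have := h.trans_le ht.2
        rw [div_lt_one hn0] at this
        exact_mod_cast this
      rw [abs_mul, div_eq_mul_one_div C, abs_of_nonneg (Real.sqrt_nonneg _)]
      have hc := interp_coef hn hosc hkn
      apply mul_le_mul hc _ (Real.sqrt_nonneg _) ((abs_nonneg _).trans hc)
      rw [← Real.sqrt_one, ← Real.sqrt_div zero_le_one]
      exact Real.sqrt_le_sqrt (by linarith)
    · rw [h, sub_self, Real.sqrt_zero, mul_zero, abs_zero]
      exact (abs_nonneg _).trans h1
  rw [hf]
  have := abs_sub (lam t - lam ((k : ℝ) / n)) (Real.sqrt n * (lam (((k : ℝ) + 1) / n) -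
    lam ((k : ℝ) / n)) * Real.sqrt (t - (k : ℝ) / n))
  calc _ = |(lam t - lam ((k : ℝ) / n)) - (Real.sqrt n * (lam (((k : ℝ) + 1) / n) -
    lam ((k : ℝ) / n)) * Real.sqrt (t - (k : ℝ) / n))| := by congr 1; ring
    _ ≤ _ := this
    _ ≤ _ := by linarith

/-- After a time of order `1/n` the interpolated flow is at height at least `1/(6C³√n)`. -/
lemma height {lam : ℝ → ℝ} {n : ℕ} (hn : 1 ≤ n) {C : ℝ} (hC : 1 ≤ C)
    (hosc : ∀ s ∈ Set.Icc (0:ℝ) 1, ∀ t ∈ Set.Icc (0:ℝ) 1, |t - s| ≤ 1 / n →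
      |lam t - lam s| ≤ C / Real.sqrt n) {t : ℝ} (ht : t ∈ Set.Icc (0:ℝ) 1)
    (htn : 1 / (2 * n : ℝ) ≤ t) {h : ℝ → ℂ}
    (H : RevSol (fun u => sqrtInterp lam n (t - u)) h 0 t)
    (h0 : (h 0).re = sqrtInterp lam n t) :
    ∃ τ ∈ Set.Icc 0 t, τ ≤ 2 / n ∧ 1 / Real.sqrt n / (6 * C ^ 3) ≤ (h τ).im := by
  have hn0 : (0 : ℝ) < n := by exact_mod_cast hn
  have hC0 : 0 < C := by linarith
  have hsn : 0 < Real.sqrt n := Real.sqrt_pos.2 hn0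
  have hC3 : 1 ≤ C ^ 2 := one_le_pow₀ hC
  obtain ⟨f1, f2⟩ := floor_facts hn ht
  set k := ⌊t * (n:ℝ)⌋₊ with hk
  set ρ := t - (k : ℝ) / n with hρ
  have e : ((k : ℝ) + 1) / n = (k : ℝ) / n + 1 / n := by ring
  have hρ0 : 0 ≤ ρ := by linarith
  have hρ1 : ρ ≤ 1 / n := by linarith
  have hkt : 0 ≤ (k : ℝ) / n := by positivity
  -- first phase
  have first : 0 < ρ → Real.sqrt ρ / C ≤ (h ρ).im ∧
      |(h ρ).re - lam ((k : ℝ) / n)| ≤ 2 * C * Real.sqrt ρ := by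
    intro hpos
    have hkn : k < n := by
      have : (k : ℝ) / n < 1 := by linarith [ht.2]
      rw [div_lt_one hn0] at this
      exact_mod_cast this
    have H1 := (H.mono (a' := 0) (b' := 0 + ρ) le_rfl (by linarith)).congr
      (ξ' := fun u => Real.sqrt n * (lam (((k : ℝ) + 1) / n) - lam ((k : ℝ) / n)) *
        Real.sqrt (0 + ρ - u) + lam ((k : ℝ) / n)) (by
        intro u hu
        rw [interp_formula lam hn k (by linarith [hu.2]) (by linarith [hu.1])]
        congr 3
        simp only [hρ]; ring)
    have := phase_one hpos (interp_coef hn hosc hkn) hC H1 (by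
      rw [h0, interp_formula lam hn k f1 f2.le])
    simpa using this
  have hsq1 : Real.sqrt (1 / (n:ℝ)) = 1 / Real.sqrt n := by
    rw [Real.sqrt_div zero_le_one, Real.sqrt_one]
  by_cases hcase : 1 / (2 * n : ℝ) ≤ ρ
  · refine ⟨ρ, ⟨hρ0, by linarith⟩, hρ1.trans (by gcongr; norm_num), ?_⟩
    have hpos : 0 < ρ := lt_of_lt_of_le (by positivity) hcase
    refine le_trans ?_ (first hpos).1
    have h1 : 1 / Real.sqrt n / 2 ≤ Real.sqrt ρ := by
      apply Real.le_sqrt_of_sq_le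
      rw [div_pow, div_pow, Real.sq_sqrt hn0.le]
      refine le_trans ?_ hcase
      rw [one_pow, div_div, div_le_div_iff₀ (by positivity) (by positivity)]
      nlinarith
    rw [le_div_iff₀ hC0]
    refine le_trans ?_ h1
    rw [div_mul_eq_mul_div, div_le_div_iff₀ (by positivity) (by norm_num)]
    have : 0 < 1 / Real.sqrt n := by positivity
    have h6 : C * 2 ≤ 6 * C ^ 3 := by nlinarith
    rw [mul_assoc]
    exact mul_le_mul_of_nonneg_left h6 this.le
  · push Not at hcase
    have hk1 : 1 ≤ k := by
      by_contra hcon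
      have : k = 0 := by omega
      rw [this] at hρ
      simp at hρ
      linarith
    obtain ⟨m, hm⟩ : ∃ m, k = m + 1 := ⟨k - 1, by omega⟩
    have hkm : (k : ℝ) = (m : ℝ) + 1 := by rw [hm]; push_cast; rfl
    have hmn : m < n := by
      have : (k : ℝ) / n ≤ 1 := by linarith [ht.2]
      rw [div_le_one hn0] at this
      have : k ≤ n := by exact_mod_cast this
      omega
    have e3 : ((m : ℝ) + 1) / n = (m : ℝ) / n + 1 / n := by ring
    have hm0 : 0 ≤ (m : ℝ) / n := by positivity
    rw [hkm] at hρ first f1 f2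
    have H2 := (H.mono (a' := ρ) (b' := ρ + 1 / n) hρ0 (by linarith)).congr
      (ξ' := fun u => Real.sqrt n * (lam (((m : ℝ) + 1) / n) - lam ((m : ℝ) / n)) *
        Real.sqrt (ρ + 1 / n - u) + lam ((m : ℝ) / n)) (by
        intro u hu
        rw [interp_formula lam hn m (by linarith [hu.2]) (by linarith [hu.1])]
        congr 3
        rw [hρ]; ring)
    have e2 : Real.sqrt n * Real.sqrt (1 / n) = 1 := by
      rw [← Real.sqrt_mul hn0.le, mul_one_div_cancel hn0.ne', Real.sqrt_one]
    have e4 : Real.sqrt n * (lam (((m : ℝ) + 1) / n) - lam ((m : ℝ) / n)) * Real.sqrt (1 / n)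
        + lam ((m : ℝ) / n) = lam (((m : ℝ) + 1) / n) := by
      linear_combination (lam (((m : ℝ) + 1) / n) - lam ((m : ℝ) / n)) * e2
    have := phase_two (by positivity) (interp_coef hn hosc hmn) hC H2 (by
      rw [e4]
      rcases hρ0.lt_or_eq with hpos | hz
      · obtain ⟨g1, g2⟩ := first hpos
        refine g2.trans ?_
        rw [div_le_iff₀ hC0] at g1
        nlinarith
      · have ht' : t = ((m : ℝ) + 1) / n := by linarith
        rw [← hz, h0, interp_formula lam hn m (by rw [ht', e3]; linarith [show 0 < 1 / (n:ℝ) by positivity]) (by rw [ht'])]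
        have : t - (m : ℝ) / n = 1 / n := by linarith
        rw [this, e4, sub_self, abs_zero]
        have := (H 0 ⟨le_rfl, ht.1⟩).1
        positivity)
    refine ⟨ρ + 1 / n, ⟨by positivity, by linarith⟩, ?_, ?_⟩
    · have : (2:ℝ) / n = 1 / n + 1 / n := by ring
      linarith
    · rw [← hsq1]; exact this

lemma IsSubpower.mul {f g : ℝ → ℝ} (hf : IsSubpower f) (hg : IsSubpower g) :
    IsSubpower (fun x => f x * g x) := by
  refine ⟨fun x => mul_nonneg (hf.1 x) (hg.1 x), fun ε hε => ?_⟩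
  have h := (hf.2 (ε / 2) (half_pos hε)).mul (hg.2 (ε / 2) (half_pos hε))
  rw [mul_zero] at h
  refine h.congr' ?_
  filter_upwards [eventually_gt_atTop 0] with x hx
  rw [div_mul_div_comm, ← Real.rpow_add hx, add_halves]

lemma IsSubpower.add {f g : ℝ → ℝ} (hf : IsSubpower f) (hg : IsSubpower g) :
    IsSubpower (fun x => f x + g x) := by
  refine ⟨fun x => add_nonneg (hf.1 x) (hg.1 x), fun ε hε => ?_⟩
  have h := (hf.2 ε hε).add (hg.2 ε hε)
  rw [add_zero] at h
  refine h.congr fun x => ?_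
  rw [add_div]

lemma isSubpower_const {c : ℝ} (hc : 0 ≤ c) : IsSubpower (fun _ => c) := by
  refine ⟨fun _ => hc, fun ε hε => ?_⟩
  exact tendsto_const_nhds.div_atTop (tendsto_rpow_atTop hε)

lemma isSubpower_log : IsSubpower (fun x => |Real.log x|) := by
  refine ⟨fun _ => abs_nonneg _, fun ε hε => ?_⟩
  have h := (isLittleO_log_rpow_atTop hε).tendsto_div_nhds_zero.abs
  rw [abs_zero] at h
  refine h.congr' ?_
  filter_upwards [eventually_gt_atTop 0] with x hx
  rw [abs_div, abs_of_pos (Real.rpow_pos_of_pos hx ε)]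

lemma IsSubpower.pow {f : ℝ → ℝ} (hf : IsSubpower f) (m : ℕ) : IsSubpower (fun x => f x ^ m) := by
  induction m with
  | zero => simpa using isSubpower_const zero_le_one
  | succ k ih => simpa [pow_succ] using ih.mul hf

lemma osc_bound {lam : ℝ → ℝ} (hc : ContinuousOn lam (Set.Icc 0 1)) {s t δ : ℝ}
    (hs : s ∈ Set.Icc (0:ℝ) 1) (ht : t ∈ Set.Icc (0:ℝ) 1) (h : |t - s| ≤ δ) :
    |lam t - lam s| ≤ osc lam δ := by
  obtain ⟨M, hM⟩ := (isCompact_Icc.exists_bound_of_continuousOn hc)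
  apply le_csSup
  · refine ⟨M + M, ?_⟩
    rintro d ⟨s, hs, t, ht, -, rfl⟩
    have h1 := hM s hs
    have h2 := hM t ht
    rw [Real.norm_eq_abs] at h1 h2
    exact (abs_sub _ _).trans (by linarith)
  · exact ⟨s, hs, t, ht, h, rfl⟩

/-- Both flows stay close to each other for a time of order `1/n`. -/
lemma near {lam : ℝ → ℝ} {n : ℕ} (hn : 1 ≤ n) {C : ℝ} (hC : 1 ≤ C)
    (hosc : ∀ s ∈ Set.Icc (0:ℝ) 1, ∀ t ∈ Set.Icc (0:ℝ) 1, |t - s| ≤ 1 / n →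
      |lam t - lam s| ≤ C / Real.sqrt n) {t : ℝ} (ht : t ∈ Set.Icc (0:ℝ) 1) {h₁ h₂ : ℝ → ℂ}
    (H1 : RevSol (fun u => lam (t - u)) h₁ 0 t)
    (H2 : RevSol (fun u => sqrtInterp lam n (t - u)) h₂ 0 t)
    (r1 : (h₁ 0).re = lam t) (r2 : (h₂ 0).re = sqrtInterp lam n t)
    (i1 : (h₁ 0).im ≤ 1 / Real.sqrt n) (i2 : (h₂ 0).im ≤ 1 / Real.sqrt n)
    {τ : ℝ} (hτ : τ ∈ Set.Icc 0 t) (hτn : τ ≤ 2 / n) :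
    ‖h₁ τ - h₂ τ‖ ≤ 9 * C / Real.sqrt n := by
  have hn0 : (0 : ℝ) < n := by exact_mod_cast hn
  have hsn : 0 < Real.sqrt n := Real.sqrt_pos.2 hn0
  have hCn : 0 < C / Real.sqrt n := div_pos (by linarith) hsn
  have hmem : ∀ u ∈ Set.Icc 0 τ, t - u ∈ Set.Icc (0:ℝ) 1 := fun u hu =>
    ⟨by linarith [hu.2, hτ.2], by linarith [hu.1, ht.2]⟩
  have hl : ∀ u ∈ Set.Icc 0 τ, |lam (t - u) - lam t| ≤ 2 * (C / Real.sqrt n) := by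
    intro u hu
    have hm : t - u / 2 ∈ Set.Icc (0:ℝ) 1 :=
      ⟨by linarith [hu.1, hu.2, hτ.2], by linarith [hu.1, ht.2]⟩
    have e : (2:ℝ) / n = 2 * (1 / n) := by ring
    have a1 := hosc _ hm _ (hmem u hu) (by
      rw [abs_le]; constructor <;> linarith [hu.1, hu.2])
    have a2 := hosc _ ht _ hm (by
      rw [abs_le]; constructor <;> linarith [hu.1, hu.2])
    have := abs_add_le (lam (t - u) - lam (t - u / 2)) (lam (t - u / 2) - lam t)
    rw [sub_add_sub_cancel] at this
    linarith
  have hl2 : ∀ u ∈ Set.Icc 0 τ, |sqrtInterp lam n (t - u) - lam t| ≤ 4 * (C / Real.sqrt n) := by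
    intro u hu
    have a1 := interp_close hn hosc (hmem u hu)
    have a2 := hl u hu
    rw [abs_sub_comm] at a1
    have := abs_add_le (sqrtInterp lam n (t - u) - lam (t - u)) (lam (t - u) - lam t)
    rw [sub_add_sub_cancel] at this
    linarith
  have h0τ : (0:ℝ) ∈ Set.Icc 0 τ := ⟨le_rfl, hτ.1⟩
  have hττ : τ ∈ Set.Icc 0 τ := ⟨hτ.1, le_rfl⟩
  have R1 := (H1.mono le_rfl hτ.2).abs_re (c := lam t) hττ
    (by rw [r1, sub_self, abs_zero]; positivity) hl
  have R2 := (H2.mono le_rfl hτ.2).abs_re (c := lam t) hττ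
    (by rw [r2]; simpa using hl2 0 h0τ) hl2
  have im3 : ∀ {ξ h}, RevSol ξ h 0 t → (h 0).im ≤ 1 / Real.sqrt n →
      0 < (h τ).im ∧ (h τ).im ≤ 3 / Real.sqrt n := by
    intro ξ h H hi
    have p0 := (H 0 ⟨le_rfl, ht.1⟩).1
    have pτ := (H τ hτ).1
    refine ⟨pτ, ?_⟩
    have h1 := H.im_le hτ
    have h2 : (h 0).im ^ 2 ≤ (1 / Real.sqrt n) ^ 2 := pow_le_pow_left₀ p0.le hi 2
    apply le_of_sq_le_sq _ (by positivity)
    rw [div_pow, Real.sq_sqrt hn0.le] at h2 ⊢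
    have e : (3:ℝ) ^ 2 / n = 1 ^ 2 / n + 4 * (2 / n) := by ring
    rw [e]
    linarith
  obtain ⟨m1, m1'⟩ := im3 H1 i1
  obtain ⟨m2, m2'⟩ := im3 H2 i2
  have hn' := Complex.norm_le_abs_re_add_abs_im (h₁ τ - h₂ τ)
  rw [Complex.sub_re, Complex.sub_im] at hn'
  have b1 : |(h₁ τ).re - (h₂ τ).re| ≤ 6 * (C / Real.sqrt n) := by
    rw [abs_le] at R1 R2 ⊢
    constructor <;> linarith
  have b2 : |(h₁ τ).im - (h₂ τ).im| ≤ 3 * (C / Real.sqrt n) := by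
    have : 3 / Real.sqrt n ≤ 3 * (C / Real.sqrt n) := by
      rw [← mul_div_assoc]; gcongr; linarith
    rw [abs_le]; constructor <;> linarith
  have e : 9 * C / Real.sqrt n = 9 * (C / Real.sqrt n) := by ring
  rw [e]; linarith

set_option maxHeartbeats 2000000 in
lemma core {lam : ℝ → ℝ} (hlam : ContinuousOn lam (Set.Icc 0 1)) {n : ℕ} (hn : 1 ≤ n) {C : ℝ}
    (hC : 1 ≤ C)
    (hosc : ∀ s ∈ Set.Icc (0:ℝ) 1, ∀ t ∈ Set.Icc (0:ℝ) 1, |t - s| ≤ 1 / n →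
      |lam t - lam s| ≤ C / Real.sqrt n) {t : ℝ} (ht : t ∈ Set.Icc (0:ℝ) 1)
    (ch : FwdLoewnerChain lam 1) (chn : FwdLoewnerChain (sqrtInterp lam n) 1)
    {c₀ β a y η : ℝ} (hc₀ : 0 < c₀) (ha0 : 0 < a) (ha1 : a ≤ 1)
    (haβ : 1 + β = 2 * a ^ 2) (hy : y = 1 / Real.sqrt n) (hη : 0 < η) (hηy : η ≤ y)
    (hder : ‖deriv (fun z => ch.finv t (z + (lam t : ℂ))) ((y : ℂ) * Complex.I)‖
              ≤ c₀ * y ^ (-β)) :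
    ‖ch.finv t ((lam t : ℂ) + y * Complex.I) -
      chn.finv t ((sqrtInterp lam n t : ℂ) + η * Complex.I)‖ ≤
      324 * Real.exp (|Real.log (3 * c₀)| / (4 * a)) * C ^ 5 * (1 + Real.log n) *
        (Real.sqrt n ^ a / Real.sqrt n) := by
  have hn0 : (0 : ℝ) < n := by exact_mod_cast hn
  have hn1 : (1 : ℝ) ≤ n := by exact_mod_cast hn
  have hsn : 0 < Real.sqrt n := Real.sqrt_pos.2 hn0
  have hsn1 : 1 ≤ Real.sqrt n := Real.one_le_sqrt.2 hn1
  have hC0 : 0 < C := by linarith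
  have hy0 : 0 < y := by rw [hy]; positivity
  have hlogn : 0 ≤ Real.log n := Real.log_nonneg hn1
  have hw1 : 0 < ((lam t : ℂ) + y * Complex.I).im := by simp [hy0]
  have hw2 : 0 < ((sqrtInterp lam n t : ℂ) + η * Complex.I).im := by simp [hη]
  obtain ⟨H1, h10, h1t⟩ := chain_rev ch ht hw1
  obtain ⟨H2, h20, h2t⟩ := chain_rev chn ht hw2
  obtain ⟨h₁, hh1⟩ : ∃ h₁ : ℝ → ℂ, h₁ = fun u => ch.g (t - u) (ch.finv t ((lam t : ℂ) + y * Complex.I)) :=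
    ⟨_, rfl⟩
  obtain ⟨h₂, hh2⟩ : ∃ h₂ : ℝ → ℂ, h₂ = fun u => chn.g (t - u)
    (chn.finv t ((sqrtInterp lam n t : ℂ) + η * Complex.I)) := ⟨_, rfl⟩
  rw [← hh1] at H1
  rw [← hh2] at H2
  replace h10 : h₁ 0 = (lam t : ℂ) + y * Complex.I := by rw [hh1]; exact h10
  replace h20 : h₂ 0 = (sqrtInterp lam n t : ℂ) + η * Complex.I := by rw [hh2]; exact h20
  rw [← h1t, ← h2t]
  rw [show ch.g (t - t) (ch.finv t ((lam t : ℂ) + y * Complex.I)) = h₁ t by rw [hh1],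
    show chn.g (t - t) (chn.finv t ((sqrtInterp lam n t : ℂ) + η * Complex.I)) = h₂ t by rw [hh2]]
  have r1 : (h₁ 0).re = lam t := by rw [h10]; simp
  have r2 : (h₂ 0).re = sqrtInterp lam n t := by rw [h20]; simp
  have i1 : (h₁ 0).im = y := by rw [h10]; simp
  have i2 : (h₂ 0).im = η := by rw [h20]; simp
  have hnear := fun τ hτ hτn => near hn hC hosc ht H1 H2 r1 r2 (i1.le.trans hy.le)
    (i2.le.trans (hηy.trans hy.le)) (τ := τ) hτ hτn
  have hK0 : 1 ≤ Real.exp (|Real.log (3 * c₀)| / (4 * a)) := Real.one_le_exp (by positivity)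
  set K0 := Real.exp (|Real.log (3 * c₀)| / (4 * a)) with hK0def
  by_cases hcase : 1 / (2 * n : ℝ) ≤ t
  swap
  · push Not at hcase
    have h := hnear t ⟨ht.1, le_rfl⟩ (hcase.le.trans (by
      rw [div_le_div_iff₀ (by positivity) hn0]; nlinarith))
    refine h.trans ?_
    have e1 : 1 ≤ Real.sqrt n ^ a := Real.one_le_rpow hsn1 ha0.le
    have e2 : C ≤ C ^ 5 := le_self_pow₀ hC (by norm_num)
    have e3 : 9 * C ≤ 324 * K0 * C ^ 5 * (1 + Real.log n) * Real.sqrt n ^ a := by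
      calc 9 * C ≤ 324 * 1 * C ^ 5 * (1 + 0) * 1 := by nlinarith
        _ ≤ _ := by gcongr
    rw [← mul_div_assoc]
    gcongr
  obtain ⟨τ, hτ, hτn, hhτ⟩ := height hn hC hosc ht hcase H2 r2
  -- antiderivative
  have hcont : ContinuousOn (fun u => 4 * ((h₁ u).re - lam (t - u)) ^ 2 /
      sqd (fun u => lam (t - u)) h₁ u ^ 2) (Set.Icc 0 t) := by
    have c1 : ContinuousOn h₁ (Set.Icc 0 t) := fun u hu =>
      (H1 u hu).2.continuousAt.continuousWithinAt
    have c2 : ContinuousOn (fun u => lam (t - u)) (Set.Icc 0 t) := by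
      apply hlam.comp (by fun_prop)
      intro u hu
      exact ⟨by linarith [hu.2], by linarith [hu.1, ht.2]⟩
    have c3 : ContinuousOn (fun u => (h₁ u).re) (Set.Icc 0 t) :=
      Complex.continuous_re.comp_continuousOn c1
    have c4 : ContinuousOn (fun u => (h₁ u).im) (Set.Icc 0 t) :=
      Complex.continuous_im.comp_continuousOn c1
    apply ContinuousOn.div
    · exact ((c3.sub c2).pow 2).const_mul 4
    · exact ((((c3.sub c2).pow 2).add (c4.pow 2))).pow 2
    · intro u hu
      exact pow_ne_zero 2 (H1.sqd_pos hu).ne'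
  obtain ⟨A, hA⟩ := exists_antideriv ht.1 hcont
  have hAm : A 0 ≤ A τ := by
    have : MonotoneOn A (Set.Icc 0 t) := by
      apply monotoneOn_of_deriv_nonneg (convex_Icc 0 t)
      · intro u hu
        exact (hA u hu).continuousAt.continuousWithinAt
      · intro u hu
        exact (hA u (interior_subset hu)).differentiableAt.differentiableWithinAt
      · intro u hu
        rw [(hA u (interior_subset hu)).deriv]
        positivity
    exact this ⟨le_rfl, ht.1⟩ hτ hτ.1
  have hcmp := compare (κ := 1 / a) (ε := 2 * (C / Real.sqrt n)) (A := A)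
    (H1.mono hτ.1 le_rfl) (H2.mono hτ.1 le_rfl) hτ.2
    (by positivity) (fun u hu => interp_close hn hosc
      ⟨by linarith [hu.2], by linarith [hu.1, hτ.1, ht.2]⟩)
    (fun u hu => hA u ⟨hτ.1.trans hu.1, hu.2⟩)
  have hAt := deriv_lower ch ht hy0 hh1 hA hder
  set ℓ := Real.log (Real.sqrt n) with hℓ
  have hℓn : 2 * ℓ = Real.log n := by
    rw [hℓ, Real.log_sqrt hn0.le]; ring
  have hlogy : Real.log y = -ℓ := by rw [hy, one_div, Real.log_inv]
  have hlogD : Real.log (c₀ * y ^ (-β)) = Real.log c₀ + β * ℓ := by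
    rw [Real.log_mul hc₀.ne' (Real.rpow_pos_of_pos hy0 _).ne', Real.log_rpow hy0, hlogy]; ring
  have htt : t ∈ Set.Icc 0 t := ⟨ht.1, le_rfl⟩
  have h0t : (0:ℝ) ∈ Set.Icc 0 t := ⟨le_rfl, ht.1⟩
  have hy1 : y ≤ 1 := by rw [hy, div_le_one hsn]; exact hsn1
  have top3 : ∀ {ξ h}, RevSol ξ h 0 t → (h 0).im ≤ y → Real.log (h t).im ≤ Real.log 3 := by
    intro ξ h H hi
    have p0 := (H 0 h0t).1
    have pt := (H t htt).1
    apply Real.log_le_log pt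
    have h1 := H.im_le htt
    nlinarith [ht.2]
  have T1 := top3 H1 i1.le
  have T2 := top3 H2 (i2.le.trans hηy)
  have L1 : -ℓ ≤ Real.log (h₁ τ).im := by
    rw [← hlogy]
    apply Real.log_le_log hy0
    rw [← i1]
    exact H1.im_mono h0t hτ hτ.1
  have L2 : -ℓ - Real.log (6 * C ^ 3) ≤ Real.log (h₂ τ).im := by
    have := Real.log_le_log (by positivity) hhτ
    rw [← hy, Real.log_div hy0.ne' (by positivity), hlogy] at this
    exact this
  have hl3c : Real.log (3 * c₀) = Real.log 3 + Real.log c₀ :=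
    Real.log_mul (by norm_num) hc₀.ne'
  have hl3 : Real.log 3 ≤ 2 := by
    have := Real.log_le_sub_one_of_pos (x := 3) (by norm_num); linarith
  have hl6 : Real.log (6 * C ^ 3) ≤ 5 * C := by
    rw [Real.log_mul (by norm_num) (by positivity), Real.log_pow]
    have := Real.log_le_sub_one_of_pos (x := 6) (by norm_num)
    have := Real.log_le_sub_one_of_pos hC0
    push_cast
    linarith
  have hl18 : Real.log 3 + Real.log (6 * C ^ 3) = Real.log (18 * C ^ 3) := by
    rw [← Real.log_mul (by norm_num) (by positivity)]; ring_nf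
  have hl18p : 0 ≤ Real.log (18 * C ^ 3) := Real.log_nonneg (by
    have : 1 ≤ C ^ 3 := one_le_pow₀ hC
    linarith)
  have hAexp : A t - A τ ≤ Real.log (3 * c₀) + 2 * a ^ 2 * ℓ := by
    rw [hlogD, hlogy] at hAt
    rw [hl3c, ← haβ]
    linarith
  have hexp : Real.exp (1 / a / 4 * (A t - A τ) + 1 / (2 * (1 / a)) *
      (Real.log (h₂ t).im - Real.log (h₂ τ).im)) ≤ Real.sqrt n ^ a * (K0 * (18 * C ^ 3)) := by
    have e1 : 1 / a / 4 * (A t - A τ) ≤ |Real.log (3 * c₀)| / (4 * a) + a / 2 * ℓ := by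
      have h1 : A t - A τ ≤ |Real.log (3 * c₀)| + 2 * a ^ 2 * ℓ := by
        linarith [le_abs_self (Real.log (3 * c₀))]
      calc 1 / a / 4 * (A t - A τ) ≤ 1 / a / 4 * (|Real.log (3 * c₀)| + 2 * a ^ 2 * ℓ) := by gcongr
        _ = _ := by field_simp; ring
    have e2 : 1 / (2 * (1 / a)) * (Real.log (h₂ t).im - Real.log (h₂ τ).im) ≤
        a / 2 * ℓ + Real.log (18 * C ^ 3) := by
      have h0 : 1 / (2 * (1 / a)) = a / 2 := by field_simp
      rw [h0]
      have h1 : Real.log (h₂ t).im - Real.log (h₂ τ).im ≤ ℓ + Real.log (18 * C ^ 3) := by linarith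
      calc a / 2 * (Real.log (h₂ t).im - Real.log (h₂ τ).im)
          ≤ a / 2 * (ℓ + Real.log (18 * C ^ 3)) := by gcongr
        _ ≤ _ := by nlinarith
    have e3 : Real.sqrt n ^ a * (K0 * (18 * C ^ 3)) =
        Real.exp (ℓ * a + (|Real.log (3 * c₀)| / (4 * a) + Real.log (18 * C ^ 3))) := by
      rw [Real.exp_add, Real.exp_add, Real.exp_log (by positivity), ← hK0def,
        Real.rpow_def_of_pos hsn]
    rw [e3]
    apply Real.exp_le_exp.2
    linarith
  have hpar : ‖h₁ τ - h₂ τ‖ + 2 * (C / Real.sqrt n) / 2 *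
      (Real.log (h₁ t).im - Real.log (h₁ τ).im + (Real.log (h₂ t).im - Real.log (h₂ τ).im)) ≤
      18 * C ^ 2 * (1 + Real.log n) / Real.sqrt n := by
    have n1 := hnear τ hτ hτn
    have n2 : Real.log (h₁ t).im - Real.log (h₁ τ).im + (Real.log (h₂ t).im - Real.log (h₂ τ).im) ≤
      4 + Real.log n + 5 * C := by linarith
    calc _ ≤ 9 * C / Real.sqrt n + C / Real.sqrt n * (4 + Real.log n + 5 * C) := by
          have : 2 * (C / Real.sqrt n) / 2 = C / Real.sqrt n := by ring
          rw [this]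
          gcongr
      _ = (C * (13 + Real.log n + 5 * C)) / Real.sqrt n := by ring
      _ ≤ _ := by
          refine div_le_div_of_nonneg_right ?_ hsn.le
          rw [pow_two]
          have : 13 + Real.log n + 5 * C ≤ 18 * C * (1 + Real.log n) := by nlinarith [mul_nonneg (sub_nonneg.2 hC) hlogn]
          nlinarith
  have hn0' : 0 ≤ Real.sqrt n ^ a * (K0 * (18 * C ^ 3)) := by positivity
  refine hcmp.trans ?_
  calc _ ≤ Real.sqrt n ^ a * (K0 * (18 * C ^ 3)) *
      (18 * C ^ 2 * (1 + Real.log n) / Real.sqrt n) :=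
        (mul_le_mul_of_nonneg_left hpar (Real.exp_pos _).le).trans
          (mul_le_mul_of_nonneg_right hexp (by positivity))
    _ = _ := by ring

/-- **Convergence of the square-root interpolated traces** (Tran, Theorem 2.2).
Suppose the driver `lam : [0,1] → ℝ` satisfies Assumption 1 (weak Hölder-1/2 continuity with
subpower function `φ`) and Assumption 2 (`|f̂'_t(iy)| ≤ c₀ y^{-β}` for `0 < y ≤ y₀`), and let
`γ` and `γⁿ` be the traces generated by `lam` and by its square-root interpolation `lamⁿ`.
Then there is a subpower function `φ̃`, depending only on `φ`, `c₀` and `β`, such that for all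
`n ≥ 1/y₀²` and `t ∈ [0,1]`,
`|γⁿ(t) − γ(t)| ≤ φ̃(n) / n^{(1/2)(1 − √((1+β)/2))}`. -/
theorem trace_sqrt_interpolation_convergence
    (φ : ℝ → ℝ) (hφ : IsSubpower φ) (c₀ β : ℝ) (hc₀ : 0 < c₀) (hβ0 : 0 < β) (hβ1 : β < 1) :
    ∃ φt : ℝ → ℝ, IsSubpower φt ∧
      ∀ (lam : ℝ → ℝ), ContinuousOn lam (Set.Icc 0 1) →
        (∀ δ ∈ Set.Ioc (0:ℝ) 1, osc lam δ ≤ Real.sqrt δ * φ (1/δ)) →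
        ∀ y₀ : ℝ, 0 < y₀ →
        ∀ ch : FwdLoewnerChain lam 1,
        (∀ t ∈ Set.Icc (0:ℝ) 1, ∀ y : ℝ, 0 < y → y ≤ y₀ →
            ‖deriv (fun z => ch.finv t (z + (lam t : ℂ))) ((y : ℂ) * Complex.I)‖
              ≤ c₀ * y ^ (-β)) →
        ∀ γ : ℝ → ℂ, HasTrace lam 1 ch γ →
        ∀ (chn : ∀ n : ℕ, FwdLoewnerChain (sqrtInterp lam n) 1) (γn : ℕ → ℝ → ℂ),
        (∀ n : ℕ, 1 ≤ n → HasTrace (sqrtInterp lam n) 1 (chn n) (γn n)) →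
        ∀ n : ℕ, 1 ≤ n → 1 / y₀ ^ 2 ≤ (n : ℝ) →
        ∀ t ∈ Set.Icc (0:ℝ) 1,
          ‖γn n t - γ t‖ ≤ φt n / (n : ℝ) ^ ((1/2) * (1 - Real.sqrt ((1 + β) / 2))) := by
  set a := Real.sqrt ((1 + β) / 2) with ha
  have ha0 : 0 < a := Real.sqrt_pos.2 (by linarith)
  have ha2 : a ^ 2 = (1 + β) / 2 := Real.sq_sqrt (by linarith)
  have ha1 : a ≤ 1 := Real.sqrt_le_one.2 (by linarith)
  have hβa : β ≤ a := Real.le_sqrt_of_sq_le (by nlinarith)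
  have h1β : 0 < 1 - β := by linarith
  set K := c₀ / (1 - β) + 324 * Real.exp (|Real.log (3 * c₀)| / (4 * a)) with hK
  have hK0 : 0 ≤ K := by positivity
  refine ⟨fun x => K * (φ x + 1) ^ 5 * (1 + |Real.log x|),
    ((isSubpower_const hK0).mul ((hφ.add (isSubpower_const zero_le_one)).pow 5)).mul
      ((isSubpower_const zero_le_one).add isSubpower_log), ?_⟩
  intro lam hlam hosc y₀ hy₀ ch hder γ hγ chn γn hγn n hn hny t ht
  have hn0 : (0 : ℝ) < n := by exact_mod_cast hn
  have hn1 : (1 : ℝ) ≤ n := by exact_mod_cast hn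
  have hsn : 0 < Real.sqrt n := Real.sqrt_pos.2 hn0
  have hsn1 : 1 ≤ Real.sqrt n := Real.one_le_sqrt.2 hn1
  have hlogn : 0 ≤ Real.log n := Real.log_nonneg hn1
  set C := φ n + 1 with hCdef
  have hC : 1 ≤ C := by linarith [hφ.1 n]
  have hosc' : ∀ s ∈ Set.Icc (0:ℝ) 1, ∀ t ∈ Set.Icc (0:ℝ) 1, |t - s| ≤ 1 / n →
      |lam t - lam s| ≤ C / Real.sqrt n := by
    intro s hs t ht hst
    have h1 := (osc_bound hlam hs ht hst).trans
      (hosc (1 / n) ⟨by positivity, by rw [div_le_one hn0]; exact hn1⟩)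
    rw [one_div_one_div, Real.sqrt_div zero_le_one, Real.sqrt_one] at h1
    refine h1.trans ?_
    rw [one_div_mul_eq_div]
    gcongr
    linarith
  obtain ⟨y, hy⟩ : ∃ y : ℝ, y = 1 / Real.sqrt n := ⟨_, rfl⟩
  have hy0 : 0 < y := by rw [hy]; positivity
  have hyy : y ≤ y₀ := by
    rw [hy, div_le_iff₀ hsn]
    have h1 : 1 / y₀ ≤ Real.sqrt n := Real.le_sqrt_of_sq_le (by rw [div_pow, one_pow]; exact hny)
    rw [div_le_iff₀ hy₀] at h1
    linarith
  have h1 := tip_dist ch hγ hc₀ hβ1 ht (hder t ht) hy0 hyy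
  have h2 : ‖ch.finv t ((lam t : ℂ) + y * Complex.I) - γn n t‖ ≤
      324 * Real.exp (|Real.log (3 * c₀)| / (4 * a)) * C ^ 5 * (1 + Real.log n) *
        (Real.sqrt n ^ a / Real.sqrt n) := by
    have hlim := (((hγn n hn).2 t ht).const_sub (ch.finv t ((lam t : ℂ) + y * Complex.I))).norm
    refine le_of_tendsto hlim ?_
    filter_upwards [Ioo_mem_nhdsGT hy0] with η hη
    exact core hlam hn hC hosc' ht ch (chn n) hc₀ ha0 ha1 (by rw [ha2]; ring) hy hη.1 hη.2.le
      (hder t ht y hy0 hyy)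
  have hpow : y ^ (1 - β) ≤ Real.sqrt n ^ a / Real.sqrt n := by
    rw [hy, Real.div_rpow zero_le_one hsn.le, Real.one_rpow, one_div, ← Real.rpow_neg hsn.le]
    nth_rewrite 3 [← Real.rpow_one (Real.sqrt n)]
    rw [← Real.rpow_sub hsn]
    exact Real.rpow_le_rpow_of_exponent_le hsn1 (by linarith)
  have hfin : Real.sqrt n ^ a / Real.sqrt n = 1 / (n : ℝ) ^ ((1/2) * (1 - a)) := by
    nth_rewrite 2 [← Real.rpow_one (Real.sqrt n)]
    rw [← Real.rpow_sub hsn, Real.sqrt_eq_rpow, ← Real.rpow_mul hn0.le, one_div ((n:ℝ) ^ _),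
      ← Real.rpow_neg hn0.le]
    congr 1
    ring
  have hP : 0 ≤ Real.sqrt n ^ a / Real.sqrt n := by positivity
  have hC5 : 1 ≤ C ^ 5 * (1 + Real.log n) :=
    one_le_mul_of_one_le_of_one_le (one_le_pow₀ hC) (by linarith)
  have h3 : c₀ / (1 - β) * y ^ (1 - β) ≤ c₀ / (1 - β) * (C ^ 5 * (1 + Real.log n)) *
      (Real.sqrt n ^ a / Real.sqrt n) := by
    rw [mul_assoc]
    apply mul_le_mul_of_nonneg_left _ (by positivity)
    exact hpow.trans (le_mul_of_one_le_left hP hC5)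
  have htri : ‖γn n t - γ t‖ ≤ ‖ch.finv t ((lam t : ℂ) + y * Complex.I) - γ t‖ +
      ‖ch.finv t ((lam t : ℂ) + y * Complex.I) - γn n t‖ := by
    have e : γn n t - γ t = (ch.finv t ((lam t : ℂ) + y * Complex.I) - γ t) -
      (ch.finv t ((lam t : ℂ) + y * Complex.I) - γn n t) := by ring
    rw [e]
    exact norm_sub_le _ _
  change ‖γn n t - γ t‖ ≤ K * C ^ 5 * (1 + |Real.log (n:ℝ)|) / (n : ℝ) ^ ((1/2) * (1 - a))
  rw [div_eq_mul_one_div, ← hfin, abs_of_nonneg hlogn]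
  calc _ ≤ _ := htri
    _ ≤ c₀ / (1 - β) * (C ^ 5 * (1 + Real.log n)) * (Real.sqrt n ^ a / Real.sqrt n) +
        324 * Real.exp (|Real.log (3 * c₀)| / (4 * a)) * C ^ 5 * (1 + Real.log n) *
        (Real.sqrt n ^ a / Real.sqrt n) := add_le_add (h1.trans h3) h2
    _ = _ := by rw [hK]; ring

end
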